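/- arXiv:1806.09413 — 2 statements merged into one kernel-verified Lean document; each statement's English description precedes it below -/
import Mathlib

section
/- Let G be an essentially 4-connected plane graph, let C be an isolating cycle of G, and assume |V⁻| ≥ 1 and |V⁺| ≥ 1. Then |M⁻ ∪ M⁺| ≥ |V⁻ ∪ V⁺| + 2. -/
open scoped Classical

noncomputable section

/-- A plane embedding (drawing) of a simple graph: vertices are mapped to distinct
points of the plane, every edge is drawn as a simple arc joining the points of its two
endvertices, arcs contain no vertex points other than their endpoints, and two distinct
arcs meet only in common endpoints. -/
structure PlaneEmbedding {V : Type*} (G : SimpleGraph V) where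
  pos : V → ℝ × ℝ
  arc : V → V → Set (ℝ × ℝ)
  pos_injective : Function.Injective pos
  arc_symm : ∀ u v, arc u v = arc v u
  arc_curve : ∀ u v, G.Adj u v → ∃ γ : ℝ → ℝ × ℝ,
      ContinuousOn γ (Set.Icc 0 1) ∧ Set.InjOn γ (Set.Icc 0 1) ∧
      γ 0 = pos u ∧ γ 1 = pos v ∧ γ '' Set.Icc 0 1 = arc u v
  arc_vertex : ∀ u v, G.Adj u v → ∀ w, pos w ∈ arc u v → w = u ∨ w = v
  arc_inter : ∀ u v x y, G.Adj u v → G.Adj x y → s(u, v) ≠ s(x, y) →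
      arc u v ∩ arc x y ⊆ Set.range pos

/-- A graph is planar if it admits a plane embedding. -/
def SimpleGraph.IsPlanar {V : Type*} (G : SimpleGraph V) : Prop :=
  Nonempty (PlaneEmbedding G)

/-- A graph is 3-connected if it has at least four vertices and deleting any set of at
most two vertices leaves a connected graph. -/
def ThreeConnected {V : Type*} [Fintype V] (G : SimpleGraph V) : Prop :=
  4 ≤ Fintype.card V ∧
    ∀ S : Finset V, S.card ≤ 2 → (G.induce ((↑S : Set V)ᶜ)).Connected

/-- `S` is a separator of `G`: deleting it leaves a disconnected graph. -/
def IsSeparator {V : Type*} [Fintype V] (G : SimpleGraph V) (S : Finset V) : Prop :=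
  ¬ (G.induce ((↑S : Set V)ᶜ)).Connected

/-- A separator `S` is trivial if some component of `G - S` is a single vertex, i.e.
some vertex outside `S` has all of its neighbours inside `S`. -/
def TrivialSeparator {V : Type*} [Fintype V] (G : SimpleGraph V) (S : Finset V) : Prop :=
  ∃ v : V, v ∉ S ∧ ∀ w : V, G.Adj v w → w ∈ S

/-- A graph is essentially 4-connected if it is 3-connected and every 3-separator is
trivial. -/
def EssentiallyFourConnected {V : Type*} [Fintype V] (G : SimpleGraph V) : Prop :=
  ThreeConnected G ∧
    ∀ S : Finset V, S.card = 3 → IsSeparator G S → TrivialSeparator G S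

/-- A cycle `C` of `G` is isolating if every component of `G - V(C)` is a single vertex
of degree 3 in `G`, i.e. every vertex not on `C` has degree 3 in `G` and all of its
neighbours on `C`. -/
def IsIsolating {V : Type*} [Fintype V] (G : SimpleGraph V) {x : V} (C : G.Walk x x) : Prop :=
  ∀ v : V, v ∉ C.support →
    (Finset.univ.filter fun w => G.Adj v w).card = 3 ∧ ∀ w : V, G.Adj v w → w ∈ C.support

/-- `C` is a longest isolating cycle of `G`. -/
def IsLongestIsolatingCycle {V : Type*} [Fintype V] (G : SimpleGraph V) {x : V}
    (C : G.Walk x x) : Prop :=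
  C.IsCycle ∧ IsIsolating G C ∧
    ∀ (y : V) (C' : G.Walk y y), C'.IsCycle → IsIsolating G C' → C'.length ≤ C.length

section PlaneSetup

variable {V : Type*} [Fintype V] {G : SimpleGraph V}

/-- The chords of the cycle `C`: edges of `G` not on `C` joining two vertices of `C`. -/
def chordSet {x : V} (C : G.Walk x x) : Set (Sym2 V) :=
  {e | e ∈ G.edgeSet ∧ e ∉ C.edges ∧ ∀ v ∈ e, v ∈ C.support}

/-- The plane graph `H` obtained from `G` by deleting all chords of `C`. -/
def Hgraph {x : V} (C : G.Walk x x) : SimpleGraph V :=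
  G.deleteEdges (chordSet C)

/-- The arc drawing an edge, as a function of the unordered edge. -/
def arcSet (emb : PlaneEmbedding G) : Sym2 V → Set (ℝ × ℝ) :=
  Sym2.lift ⟨emb.arc, emb.arc_symm⟩

/-- The point set of the drawing of the subgraph of `H'` induced on the vertex set `s`
(in the embedding `emb` of `G`). -/
def drawingOn (emb : PlaneEmbedding G) (H' : SimpleGraph V) (s : Set V) : Set (ℝ × ℝ) :=
  emb.pos '' s ∪
    ⋃ (u : V) (v : V) (_ : H'.Adj u v) (_ : u ∈ s) (_ : v ∈ s), emb.arc u v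

/-- The drawing of `H`. -/
def drawingH (emb : PlaneEmbedding G) {x : V} (C : G.Walk x x) : Set (ℝ × ℝ) :=
  drawingOn emb (Hgraph C) Set.univ

/-- `f` is a face of the drawing `D`: a connected component of its complement. -/
def IsFaceOf (D : Set (ℝ × ℝ)) (f : Set (ℝ × ℝ)) : Prop :=
  ∃ z : ℝ × ℝ, z ∉ D ∧ f = connectedComponentIn Dᶜ z

/-- The drawing of the cycle `C`. -/
def drawC (emb : PlaneEmbedding G) {x : V} (C : G.Walk x x) : Set (ℝ × ℝ) :=
  ⋃ e ∈ C.edges, arcSet emb e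

/-- The open region strictly inside the closed curve given by `C`: the points off the
curve whose connected component in the complement is bounded. -/
def insideC (emb : PlaneEmbedding G) {x : V} (C : G.Walk x x) : Set (ℝ × ℝ) :=
  {z | z ∉ drawC emb C ∧ Bornology.IsBounded (connectedComponentIn (drawC emb C)ᶜ z)}

/-- The vertices of `G` strictly inside `C`. -/
def Vminus (emb : PlaneEmbedding G) {x : V} (C : G.Walk x x) : Finset V :=
  Finset.univ.filter fun v => v ∉ C.support ∧ emb.pos v ∈ insideC emb C

/-- The vertices of `G` strictly outside `C`:  `V⁺ = V - V(C) - V⁻`. -/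
def Vplus (emb : PlaneEmbedding G) {x : V} (C : G.Walk x x) : Finset V :=
  Finset.univ.filter fun v => v ∉ C.support ∧ v ∉ Vminus emb C

/-- A face `f` is incident with the vertex `v`. -/
def incVertex (emb : PlaneEmbedding G) (f : Set (ℝ × ℝ)) (v : V) : Prop :=
  emb.pos v ∈ closure f

/-- A face `f` is incident with the edge `e` (the arc of `e` lies on the boundary). -/
def incEdge (emb : PlaneEmbedding G) (f : Set (ℝ × ℝ)) (e : Sym2 V) : Prop :=
  arcSet emb e ⊆ closure f

/-- A minor face of the drawing `D`: a face incident with exactly one vertex of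
`V⁻ ∪ V⁺`. -/
def MinorFaceOf (emb : PlaneEmbedding G) {x : V} (C : G.Walk x x)
    (D : Set (ℝ × ℝ)) (f : Set (ℝ × ℝ)) : Prop :=
  IsFaceOf D f ∧ ∃! v : V, v ∈ Vminus emb C ∪ Vplus emb C ∧ incVertex emb f v

/-- `M⁻`: the minor faces of `H⁻ = H - V⁺`. -/
def Mminus (emb : PlaneEmbedding G) {x : V} (C : G.Walk x x) : Set (Set (ℝ × ℝ)) :=
  {f | MinorFaceOf emb C (drawingOn emb (Hgraph C) ((↑(Vplus emb C) : Set V)ᶜ)) f}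

/-- `M⁺`: the minor faces of `H⁺ = H - V⁻`. -/
def Mplus (emb : PlaneEmbedding G) {x : V} (C : G.Walk x x) : Set (Set (ℝ × ℝ)) :=
  {f | MinorFaceOf emb C (drawingOn emb (Hgraph C) ((↑(Vminus emb C) : Set V)ᶜ)) f}

/-- A minor face of `H`. -/
def MinorFaceH (emb : PlaneEmbedding G) {x : V} (C : G.Walk x x) (f : Set (ℝ × ℝ)) : Prop :=
  MinorFaceOf emb C (drawingH emb C) f

/-- A major face of `H`: a face of `H` that is not minor. -/
def MajorFaceH (emb : PlaneEmbedding G) {x : V} (C : G.Walk x x) (f : Set (ℝ × ℝ)) : Prop :=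
  IsFaceOf (drawingH emb C) f ∧ ¬ MinorFaceH emb C f

/-- The number of `C`-edges of a face `f` (so `f` is a `j`-face when this equals `j`). -/
def numCEdges (emb : PlaneEmbedding G) {x : V} (C : G.Walk x x) (f : Set (ℝ × ℝ)) : ℕ :=
  (C.edges.toFinset.filter fun e => incEdge emb f e).card

/-- `m_{f,f'}`: the number of common `C`-edges of the faces `f` and `f'`. -/
def mEdges (emb : PlaneEmbedding G) {x : V} (C : G.Walk x x)
    (f f' : Set (ℝ × ℝ)) : ℕ :=
  (C.edges.toFinset.filter fun e => incEdge emb f e ∧ incEdge emb f' e).card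

/-- `f'` is opposite to `f` (with respect to some `C`-edge incident with both). -/
def OppositeFaces (emb : PlaneEmbedding G) {x : V} (C : G.Walk x x)
    (f f' : Set (ℝ × ℝ)) : Prop :=
  f ≠ f' ∧ ∃ e ∈ C.edges, incEdge emb f e ∧ incEdge emb f' e

/-- `e` is the middle `C`-edge of the face `f` (for a 3-face, the `C`-edge sharing an
endvertex with every other `C`-edge of `f`). -/
def IsMiddleCEdge (emb : PlaneEmbedding G) {x : V} (C : G.Walk x x)
    (f : Set (ℝ × ℝ)) (e : Sym2 V) : Prop :=
  e ∈ C.edges ∧ incEdge emb f e ∧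
    ∀ e' ∈ C.edges, incEdge emb f e' → e' ≠ e → ∃ v : V, v ∈ e ∧ v ∈ e'

/-- The total weight sent from the face `f` to the face `f'` by the discharging rules
R1–R5 (each rule applied exactly once). -/
def sendWeight (emb : PlaneEmbedding G) {x : V} (C : G.Walk x x)
    (f f' : Set (ℝ × ℝ)) : ℚ :=
  -- R1: a major face sends `m_{f,f'}` to every opposite minor face
  (if MajorFaceH emb C f ∧ MinorFaceH emb C f' ∧ OppositeFaces emb C f f'
    then (mEdges emb C f f' : ℚ) else 0)
  -- R2: a minor face sends `(2/3)·m_{f,f'}` to every opposite minor 2-face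
  + (if MinorFaceH emb C f ∧ MinorFaceH emb C f' ∧ numCEdges emb C f' = 2 ∧
        OppositeFaces emb C f f'
    then 2 / 3 * (mEdges emb C f f' : ℚ) else 0)
  -- R3: a minor face sends 1 to every minor 3-face opposite with respect to its middle
  -- `C`-edge
  + (if MinorFaceH emb C f ∧ MinorFaceH emb C f' ∧ numCEdges emb C f' = 3 ∧ f ≠ f' ∧
        (∃ e : Sym2 V, IsMiddleCEdge emb C f' e ∧ incEdge emb f e)
    then 1 else 0)
  -- R4
  + (if MinorFaceH emb C f ∧ 4 ≤ numCEdges emb C f ∧ MinorFaceH emb C f' ∧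
        numCEdges emb C f' = 4 ∧ OppositeFaces emb C f' f ∧ mEdges emb C f' f = 2 ∧
        (∃ f₂ : Set (ℝ × ℝ), MinorFaceH emb C f₂ ∧
          (numCEdges emb C f₂ = 2 ∨ numCEdges emb C f₂ = 3) ∧
          OppositeFaces emb C f' f₂ ∧ mEdges emb C f' f₂ = 2)
    then 2 / 3 else 0)
  -- R5
  + (if MinorFaceH emb C f ∧ 4 ≤ numCEdges emb C f ∧ MinorFaceH emb C f' ∧
        numCEdges emb C f' = 5 ∧ OppositeFaces emb C f' f ∧ mEdges emb C f' f = 2 ∧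
        (∃ g₁ g₂ : Set (ℝ × ℝ), g₁ ≠ g₂ ∧
          MinorFaceH emb C g₁ ∧ numCEdges emb C g₁ = 2 ∧ OppositeFaces emb C f' g₁ ∧
          MinorFaceH emb C g₂ ∧ numCEdges emb C g₂ = 2 ∧ OppositeFaces emb C f' g₂)
    then 1 / 3 else 0)

/-- The final weight of a face `f` after discharging: the initial charge `j` of a
`j`-face, minus everything sent, plus everything received. -/
def wFace (emb : PlaneEmbedding G) {x : V} (C : G.Walk x x) (f : Set (ℝ × ℝ)) : ℚ :=
  (numCEdges emb C f : ℚ) - (∑ᶠ f' : Set (ℝ × ℝ), sendWeight emb C f f')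
    + ∑ᶠ f' : Set (ℝ × ℝ), sendWeight emb C f' f

end PlaneSetup


section

open Set

/-- `φ` has a continuous logarithm on `S`. -/
def HasLogOn {X : Type*} [TopologicalSpace X] (S : Set X) (φ : X → ℂ) : Prop :=
  ∃ g : X → ℂ, ContinuousOn g S ∧ ∀ z ∈ S, Complex.exp (g z) = φ z

section Log

variable {X : Type*} [TopologicalSpace X] {S T : Set X} {φ ψ : X → ℂ}

theorem HasLogOn.mono (h : HasLogOn T φ) (hST : S ⊆ T) : HasLogOn S φ :=
  let ⟨g, hg, hgφ⟩ := h
  ⟨g, hg.mono hST, fun z hz => hgφ z (hST hz)⟩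

theorem HasLogOn.congr (h : HasLogOn S φ) (hφ : ∀ z ∈ S, φ z = ψ z) : HasLogOn S ψ :=
  let ⟨g, hg, hgφ⟩ := h
  ⟨g, hg, fun z hz => (hgφ z hz).trans (hφ z hz)⟩

theorem HasLogOn.mul (h : HasLogOn S φ) (h' : HasLogOn S ψ) :
    HasLogOn S (fun z => φ z * ψ z) := by
  obtain ⟨g, hg, hgφ⟩ := h
  obtain ⟨k, hk, hkψ⟩ := h'
  exact ⟨fun z => g z + k z, hg.add hk, fun z hz => by rw [Complex.exp_add, hgφ z hz, hkψ z hz]⟩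

theorem exists_int_of_exp_eq (hS : IsPreconnected S) {g k : X → ℂ} (hg : ContinuousOn g S)
    (hk : ContinuousOn k S) (h : ∀ z ∈ S, Complex.exp (g z) = Complex.exp (k z)) :
    ∃ n : ℤ, ∀ z ∈ S, g z = k z + n * (2 * Real.pi * Complex.I) := by
  rcases S.eq_empty_or_nonempty with rfl | ⟨z₀, hz₀⟩
  · exact ⟨0, by simp⟩
  obtain ⟨n, hn⟩ := Complex.exp_eq_exp_iff_exists_int.1 (h z₀ hz₀)
  refine ⟨n, Complex.isCoveringMap_exp.eqOn_of_comp_eqOn hS hg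
    (hk.add continuousOn_const) (fun z hz => Subtype.ext ?_) hz₀ hn⟩
  simpa [Complex.exp_periodic.int_mul n (k z)] using h z hz

theorem HasLogOn.union_of_eq {g k : X → ℂ} (hST : (IsOpen S ∧ IsOpen T) ∨ (IsClosed S ∧ IsClosed T))
    (hg : ContinuousOn g S) (hk : ContinuousOn k T) (hgφ : ∀ z ∈ S, Complex.exp (g z) = φ z)
    (hkφ : ∀ z ∈ T, Complex.exp (k z) = φ z) (n : ℤ)
    (hgk : ∀ z ∈ S ∩ T, g z = k z + n * (2 * Real.pi * Complex.I)) : HasLogOn (S ∪ T) φ := by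
  set G : X → ℂ := fun z => if z ∈ S then g z else k z + n * (2 * Real.pi * Complex.I) with hG
  have hGS : EqOn G g S := fun z hz => by simp [hG, hz]
  have hGT : EqOn G (fun z => k z + n * (2 * Real.pi * Complex.I)) T := fun z hz => by
    by_cases hzS : z ∈ S
    · simp [hG, hzS, hgk z ⟨hzS, hz⟩]
    · simp [hG, hzS]
  have hcS : ContinuousOn G S := hg.congr hGS
  have hcT : ContinuousOn G T := (hk.add continuousOn_const).congr hGT
  refine ⟨G, ?_, ?_⟩
  · rcases hST with ⟨h1, h2⟩ | ⟨h1, h2⟩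
    · exact hcS.union_of_isOpen hcT h1 h2
    · exact hcS.union_of_isClosed hcT h1 h2
  · rintro z (hz | hz)
    · rw [hGS hz, hgφ z hz]
    · rw [hGT hz]
      simpa [Complex.exp_periodic.int_mul n (k z)] using hkφ z hz

theorem HasLogOn.union (hST : (IsOpen S ∧ IsOpen T) ∨ (IsClosed S ∧ IsClosed T))
    (hS : HasLogOn S φ) (hT : HasLogOn T φ) (h : IsPreconnected (S ∩ T)) :
    HasLogOn (S ∪ T) φ := by
  obtain ⟨g, hg, hgφ⟩ := hS
  obtain ⟨k, hk, hkφ⟩ := hT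
  obtain ⟨n, hn⟩ := exists_int_of_exp_eq h (hg.mono inter_subset_left) (hk.mono inter_subset_right)
    fun z hz => (hgφ z hz.1).trans (hkφ z hz.2).symm
  exact HasLogOn.union_of_eq hST hg hk hgφ hkφ n hn

theorem Continuous.hasLogOn [SimplyConnectedSpace X] [LocallyPathConnectedSpace X]
    (hφ : Continuous φ) (h0 : ∀ z, φ z ≠ 0) (S : Set X) : HasLogOn S φ := by
  obtain ⟨z₀⟩ : Nonempty X := inferInstance
  obtain ⟨F, ⟨-, hF⟩, -⟩ := Complex.isCoveringMapOn_exp.existsUnique_continuousMap_lifts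
    ⟨φ, hφ⟩ (a₀ := z₀) (Complex.exp_log (h0 z₀)) h0
  exact ⟨F, F.continuous.continuousOn, fun z _ => congr_fun hF z⟩

theorem hasLogOn_image_Icc [T2Space X] [NormalSpace X] {γ : ℝ → X} {s t : ℝ} (hst : s ≤ t)
    (hγ : ContinuousOn γ (Icc s t)) (hinj : InjOn γ (Icc s t))
    (hφ : ContinuousOn φ (γ '' Icc s t)) (h0 : ∀ z ∈ γ '' Icc s t, φ z ≠ 0) :
    HasLogOn (γ '' Icc s t) φ := by
  have hψ : Continuous fun r : ℝ => φ (γ (projIcc s t hst r)) :=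
    (hφ.comp hγ (mapsTo_image _ _)).comp_continuous
      (continuous_subtype_val.comp continuous_projIcc) fun r => (projIcc s t hst r).2
  obtain ⟨L, hL, hLψ⟩ := hψ.hasLogOn (fun r => h0 _ ⟨_, (projIcc s t hst r).2, rfl⟩) univ
  have hemb : Topology.IsClosedEmbedding ((Icc s t).domRestrict γ) :=
    (continuousOn_iff_continuous_domRestrict.1 hγ).isClosedEmbedding (injOn_iff_injective.1 hinj)
  obtain ⟨G, hG⟩ := ContinuousMap.exists_extension' hemb
    ⟨fun r : Icc s t => L r, (continuousOn_univ.1 hL).comp continuous_subtype_val⟩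
  refine ⟨G, G.continuous.continuousOn, ?_⟩
  rintro _ ⟨r, hr, rfl⟩
  have h1 : G (γ r) = L r := congr_fun hG ⟨r, hr⟩
  simp only [h1, hLψ r trivial, projIcc_of_mem hst hr]

end Log

/-- The identification of the plane with `ℂ`. -/
def planeToComplex (z : ℝ × ℝ) : ℂ := Complex.equivRealProdCLM.symm z

local notation "ζ" => planeToComplex

theorem continuous_planeToComplex : Continuous ζ := Complex.equivRealProdCLM.symm.continuous

theorem planeToComplex_injective : Function.Injective ζ := Complex.equivRealProdCLM.symm.injective

theorem planeToComplex_sub_ne_zero {z p : ℝ × ℝ} (h : z ≠ p) : ζ z - ζ p ≠ 0 :=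
  sub_ne_zero.2 (planeToComplex_injective.ne h)

theorem planeToComplex_mk (a b : ℝ) : ζ (a, b) = a + b * Complex.I := by
  simp [planeToComplex, Complex.equivRealProdCLM_symm_apply]

theorem continuousOn_planeToComplex_sub_zpow {S : Set (ℝ × ℝ)} {p : ℝ × ℝ} (hp : p ∉ S) (a : ℤ) :
    ContinuousOn (fun z => (ζ z - ζ p) ^ a) S :=
  ((continuous_planeToComplex.sub continuous_const).continuousOn).zpow₀ a fun _ hz =>
    Or.inl (planeToComplex_sub_ne_zero (ne_of_mem_of_not_mem hz hp))

theorem JoinedIn.hasLogOn {S : Set (ℝ × ℝ)} {p q : ℝ × ℝ} (h : JoinedIn Sᶜ p q) :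
    HasLogOn S (fun z => (ζ z - ζ p) / (ζ z - ζ q)) := by
  have hγ := h.symm.somePath_mem
  set γ := h.symm.somePath
  have hne : ∀ (z : S) t, ζ z - ζ (γ t) ≠ 0 := fun z t =>
    planeToComplex_sub_ne_zero (ne_of_mem_of_not_mem z.2 (hγ t))
  have hq : ∀ z : S, ζ z - ζ q ≠ 0 := fun z => by simpa using hne z 0
  let H : C(unitInterval × S, {z : ℂ // z ≠ 0}) :=
    ⟨fun x => ⟨(ζ x.2 - ζ (γ x.1)) / (ζ x.2 - ζ q), div_ne_zero (hne _ _) (hq _)⟩, by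
      have h1 : Continuous fun x : unitInterval × S => ζ x.2 :=
        continuous_planeToComplex.comp (continuous_subtype_val.comp continuous_snd)
      have h2 : Continuous fun x : unitInterval × S => ζ (γ x.1) :=
        continuous_planeToComplex.comp (γ.continuous.comp continuous_fst)
      exact Continuous.subtype_mk ((h1.sub h2).div (h1.sub continuous_const) fun x => hq x.2) _⟩
  have H0 : ∀ z : S, H (0, z) = ⟨_, Complex.exp_ne_zero ((ContinuousMap.const S (0 : ℂ)) z)⟩ :=
    fun z => Subtype.ext (by simp [H, div_self (hq z)])
  let G := Complex.isCoveringMap_exp.liftHomotopy H (.const S 0) H0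
  have hG : ∀ z : S, Complex.exp (G (1, z)) = (ζ z - ζ p) / (ζ z - ζ q) := fun z => by
    have := congr_fun (Complex.isCoveringMap_exp.liftHomotopy_lifts H (.const S 0) H0) (1, z)
    have h1 : Complex.exp (G (1, z)) = (ζ z - ζ (γ 1)) / (ζ z - ζ q) := congr_arg Subtype.val this
    rwa [γ.target] at h1
  refine ⟨fun z => if hz : z ∈ S then G (1, ⟨z, hz⟩) else 0, ?_, fun z hz => ?_⟩
  · rw [continuousOn_iff_continuous_domRestrict]
    convert G.continuous.comp (Continuous.prodMk_right (1 : unitInterval)) using 1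
    ext z
    simp
  · simpa [hz] using hG ⟨z, hz⟩

theorem IsPathConnected.hasLogOn {P S : Set (ℝ × ℝ)} (hP : IsPathConnected P) (hPS : Disjoint P S)
    {p q : ℝ × ℝ} (hp : p ∈ P) (hq : q ∈ P) :
    HasLogOn S (fun z => (ζ z - ζ p) / (ζ z - ζ q)) :=
  JoinedIn.hasLogOn ((hP.joinedIn p hp q hq).mono hPS.subset_compl_right)

theorem not_hasLogOn_circle {p : ℝ × ℝ} {r : ℝ} (hr : 0 < r) {a : ℤ} (ha : a ≠ 0) :
    ¬ HasLogOn {z | ‖ζ z - ζ p‖ = r} (fun z => (ζ z - ζ p) ^ a) := by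
  rintro ⟨g, hg, hgφ⟩
  set c : ℝ → ℝ × ℝ := fun θ => (p.1 + r * Real.cos θ, p.2 + r * Real.sin θ) with hc
  have hcont : Continuous c := by fun_prop
  have hζ : ∀ θ, ζ (c θ) - ζ p = Complex.exp (Real.log r + θ * Complex.I) := fun θ => by
    rw [Complex.exp_add, ← Complex.ofReal_exp, Real.exp_log hr, Complex.exp_mul_I, hc,
      show ζ p = ζ (p.1, p.2) from rfl, planeToComplex_mk, planeToComplex_mk]
    push_cast
    ring
  have hmem : ∀ θ, c θ ∈ {z | ‖ζ z - ζ p‖ = r} := fun θ => by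
    simp [hζ, Complex.norm_exp, Real.exp_log hr]
  obtain ⟨n, hn⟩ := exists_int_of_exp_eq (S := univ) isPreconnected_univ
    (g := fun θ => g (c θ)) (k := fun θ : ℝ => (a : ℂ) * (Real.log r + θ * Complex.I))
    (hg.comp_continuous hcont hmem).continuousOn (by fun_prop) fun θ _ => by
      simp only [hgφ _ (hmem θ), hζ, Complex.exp_int_mul]
  have h0 := hn 0 trivial
  have h1 := hn (2 * Real.pi) trivial
  have h2 : c (2 * Real.pi) = c 0 := by simp [hc]
  simp only [h2] at h1
  rw [h0] at h1
  have : (a : ℂ) * (2 * Real.pi * Complex.I) = 0 := by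
    push_cast at h1
    linear_combination -h1
  simp [ha, Real.pi_ne_zero] at this

theorem frontier_connectedComponentIn_subset {K : Set (ℝ × ℝ)} (hK : IsClosed K) (p : ℝ × ℝ) :
    frontier (connectedComponentIn Kᶜ p) ⊆ K := by
  intro x hx
  by_contra hxK
  have hopen := hK.isOpen_compl.connectedComponentIn (x := p)
  obtain ⟨y, hy1, hy2⟩ := mem_closure_iff.1 hx.1 _ (hK.isOpen_compl.connectedComponentIn (x := x))
    (mem_connectedComponentIn hxK)
  refine hx.2 ?_
  rw [hopen.interior_eq, connectedComponentIn_eq hy2, ← connectedComponentIn_eq hy1]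
  exact mem_connectedComponentIn hxK

theorem closure_connectedComponentIn_subset {K : Set (ℝ × ℝ)} (hK : IsClosed K) (p : ℝ × ℝ) :
    closure (connectedComponentIn Kᶜ p) ⊆ connectedComponentIn Kᶜ p ∪ K := by
  rw [closure_eq_self_union_frontier]
  exact union_subset_union_right _ (frontier_connectedComponentIn_subset hK p)

theorem not_hasLogOn_of_isBounded {K : Set (ℝ × ℝ)} (hK : IsClosed K) {p : ℝ × ℝ} (hp : p ∉ K)
    (hb : Bornology.IsBounded (connectedComponentIn Kᶜ p)) {a : ℤ} (ha : a ≠ 0)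
    {u : ℝ × ℝ → ℂ} (hu : ContinuousOn u (connectedComponentIn Kᶜ p ∪ K))
    (hu0 : ∀ z ∈ connectedComponentIn Kᶜ p ∪ K, u z ≠ 0) :
    ¬ HasLogOn K (fun z => (ζ z - ζ p) ^ a * u z) := by
  rintro ⟨g, hg, hgφ⟩
  set Ω := connectedComponentIn Kᶜ p with hΩ
  have hcl : closure Ω ⊆ Ω ∪ K := closure_connectedComponentIn_subset hK p
  have hΩo : IsOpen Ω := hK.isOpen_compl.connectedComponentIn
  have hpΩ : p ∈ Ω := mem_connectedComponentIn hp
  obtain ⟨G, hG⟩ := ContinuousMap.exists_restrict_eq hK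
    ⟨K.domRestrict g, continuousOn_iff_continuous_domRestrict.1 hg⟩
  have hGK : ∀ z ∈ K, G z = g z := fun z hz => DFunLike.congr_fun hG ⟨z, hz⟩
  set F : ℝ × ℝ → ℂ := fun z => if z ∈ Ω then Complex.exp (G z) / u z else (ζ z - ζ p) ^ a
  have hF : Continuous F := by
    refine continuous_if (fun z hz => ?_) ?_ ?_
    · have hzK := frontier_connectedComponentIn_subset hK p hz
      rw [hGK z hzK, hgφ z hzK, mul_div_cancel_right₀ _ (hu0 z (Or.inr hzK))]
    · exact (Complex.continuous_exp.comp G.continuous).continuousOn.div (hu.mono hcl)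
        fun z hz => hu0 z (hcl hz)
    · refine continuousOn_planeToComplex_sub_zpow (fun h => ?_) a
      rw [show {z | z ∉ Ω} = Ωᶜ from rfl, hΩo.isClosed_compl.closure_eq] at h
      exact h hpΩ
  have hF0 : ∀ z, F z ≠ 0 := fun z => by
    by_cases hz : z ∈ Ω
    · simpa [F, hz] using hu0 z (Or.inl hz)
    · simpa [F, hz] using zpow_ne_zero a
        (planeToComplex_sub_ne_zero (ne_of_mem_of_not_mem hpΩ hz).symm)
  obtain ⟨R, hR⟩ := (Metric.isBounded_iff_subset_ball (ζ p)).1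
    ((Complex.equivRealProdCLM.symm : (ℝ × ℝ) →L[ℝ] ℂ).lipschitz.isBounded_image hb)
  have hout : ∀ z, ‖ζ z - ζ p‖ = max R 1 → z ∉ Ω := fun z hz hzΩ => by
    have := hR (mem_image_of_mem _ hzΩ)
    rw [mem_ball_iff_norm] at this
    exact absurd (hz ▸ this : max R 1 < R) (not_lt.2 (le_max_left _ _))
  refine not_hasLogOn_circle (p := p) (lt_of_lt_of_le one_pos (le_max_right R 1)) ha
    ((hF.hasLogOn hF0 _).congr fun z hz => ?_)
  simp [F, hout z hz]

theorem isPreconnected_compl_closedBall (R : ℝ) :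
    IsPreconnected (Metric.closedBall (0 : ℝ × ℝ) R)ᶜ := by
  have hrank : 1 < Module.rank ℝ (ℝ × ℝ) := by simp [one_add_one_eq_two]
  rcases lt_or_ge R 0 with hR | hR
  · simpa [Metric.closedBall_eq_empty.2 hR] using isPreconnected_univ
  have h1 := ((isPathConnected_sphere hrank (0 : ℝ × ℝ) zero_le_one).isConnected.isPreconnected.prod
    (isPreconnected_Ioi (a := R))).image (fun x => x.2 • x.1) (by fun_prop)
  convert h1 using 1
  ext z
  simp only [mem_compl_iff, mem_closedBall_zero_iff, not_le, mem_image, mem_prod,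
    mem_sphere_zero_iff_norm, mem_Ioi, Prod.exists]
  constructor
  · intro hz
    have hz0 : ‖z‖ ≠ 0 := (hR.trans_lt hz).ne'
    refine ⟨(‖z‖⁻¹ • z).1, (‖z‖⁻¹ • z).2, ‖z‖, ⟨?_, hz⟩, ?_⟩
    · rw [Prod.mk.eta, norm_smul, norm_inv, norm_norm, inv_mul_cancel₀ hz0]
    · rw [Prod.mk.eta, smul_smul, mul_inv_cancel₀ hz0, one_smul]
  · rintro ⟨a, b, t, ⟨h1, h2⟩, rfl⟩
    rw [norm_smul, h1, mul_one, Real.norm_of_nonneg (hR.trans h2.le)]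
    exact h2

theorem isBounded_or_isBounded_of_ne {K : Set (ℝ × ℝ)} (hK : IsCompact K) {p q : ℝ × ℝ}
    (h : connectedComponentIn Kᶜ p ≠ connectedComponentIn Kᶜ q) :
    Bornology.IsBounded (connectedComponentIn Kᶜ p) ∨
      Bornology.IsBounded (connectedComponentIn Kᶜ q) := by
  by_contra! hcon
  obtain ⟨R, hR⟩ := (Metric.isBounded_iff_subset_closedBall 0).1 hK.isBounded
  have key : ∀ x, ¬ Bornology.IsBounded (connectedComponentIn Kᶜ x) →
      ∃ y ∈ connectedComponentIn Kᶜ x, y ∈ (Metric.closedBall (0 : ℝ × ℝ) R)ᶜ := fun x hx => by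
    by_contra! hall
    exact hx (Metric.isBounded_closedBall.subset fun y hy => not_not.1 (hall y hy))
  obtain ⟨y, hy, hyR⟩ := key p hcon.1
  obtain ⟨w, hw, hwR⟩ := key q hcon.2
  refine h ?_
  rw [connectedComponentIn_eq hy, connectedComponentIn_eq hw]
  exact connectedComponentIn_eq ((isPreconnected_compl_closedBall R).subset_connectedComponentIn
    hyR (compl_subset_compl.2 hR) hwR)

theorem not_mem_connectedComponentIn_union {K : Set (ℝ × ℝ)} {p q : ℝ × ℝ} (hq : q ∉ K)
    (h : connectedComponentIn Kᶜ p ≠ connectedComponentIn Kᶜ q) :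
    q ∉ connectedComponentIn Kᶜ p ∪ K := by
  rintro (h' | h')
  · exact h (connectedComponentIn_eq h')
  · exact hq h'

theorem not_hasLogOn_of_ne {K : Set (ℝ × ℝ)} (hK : IsCompact K) {p q r : ℝ × ℝ} (hp : p ∉ K)
    (hq : q ∉ K) (hr : r ∉ K) (hpq : connectedComponentIn Kᶜ p ≠ connectedComponentIn Kᶜ q)
    (hpr : connectedComponentIn Kᶜ p ≠ connectedComponentIn Kᶜ r)
    (hqr : connectedComponentIn Kᶜ q ≠ connectedComponentIn Kᶜ r)
    {a b : ℤ} (ha : a ≠ 0) (hb : b ≠ 0) (c : ℤ) :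
    ¬ HasLogOn K (fun z => (ζ z - ζ p) ^ a * ((ζ z - ζ q) ^ b * (ζ z - ζ r) ^ c)) := by
  have hcont : ∀ {x y : ℝ × ℝ} {S : Set (ℝ × ℝ)} (m n : ℤ), x ∉ S → y ∉ S →
      ContinuousOn (fun z => (ζ z - ζ x) ^ m * (ζ z - ζ y) ^ n) S := fun m n hx hy =>
    (continuousOn_planeToComplex_sub_zpow hx m).mul (continuousOn_planeToComplex_sub_zpow hy n)
  have hne : ∀ {x y : ℝ × ℝ} {S : Set (ℝ × ℝ)} (m n : ℤ), x ∉ S → y ∉ S →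
      ∀ z ∈ S, (ζ z - ζ x) ^ m * (ζ z - ζ y) ^ n ≠ 0 := fun m n hx hy z hz =>
    mul_ne_zero (zpow_ne_zero _ (planeToComplex_sub_ne_zero (ne_of_mem_of_not_mem hz hx)))
      (zpow_ne_zero _ (planeToComplex_sub_ne_zero (ne_of_mem_of_not_mem hz hy)))
  have hr' := not_mem_connectedComponentIn_union hr hpr
  have hr'' := not_mem_connectedComponentIn_union hr hqr
  rcases isBounded_or_isBounded_of_ne hK hpq with hbd | hbd
  · have hq' := not_mem_connectedComponentIn_union hq hpq
    exact not_hasLogOn_of_isBounded hK.isClosed hp hbd ha (hcont b c hq' hr') (hne b c hq' hr')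
  · have hp' := not_mem_connectedComponentIn_union hp hpq.symm
    exact fun h => not_hasLogOn_of_isBounded hK.isClosed hq hbd hb (hcont a c hp' hr'')
      (hne a c hp' hr'') (h.congr fun z _ => by ring)

theorem connectedComponentIn_eq_of_hasLogOn {K : Set (ℝ × ℝ)} (hK : IsCompact K) {p q : ℝ × ℝ}
    (hp : p ∉ K) (hq : q ∉ K) (h : HasLogOn K (fun z => (ζ z - ζ p) / (ζ z - ζ q))) :
    connectedComponentIn Kᶜ p = connectedComponentIn Kᶜ q := by
  by_contra hne
  have hbdd : ∀ {x y : ℝ × ℝ} (a b : ℤ), x ∉ K → y ∉ K →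
      connectedComponentIn Kᶜ x ≠ connectedComponentIn Kᶜ y →
      Bornology.IsBounded (connectedComponentIn Kᶜ x) → a ≠ 0 →
      ¬ HasLogOn K (fun z => (ζ z - ζ x) ^ a * (ζ z - ζ y) ^ b) := fun a b hx hy hxy hbd ha =>
    have hy' := not_mem_connectedComponentIn_union hy hxy
    not_hasLogOn_of_isBounded hK.isClosed hx hbd ha (continuousOn_planeToComplex_sub_zpow hy' b)
      fun z hz => zpow_ne_zero _ (planeToComplex_sub_ne_zero (ne_of_mem_of_not_mem hz hy'))
  rcases isBounded_or_isBounded_of_ne hK hne with hbd | hbd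
  · exact hbdd 1 (-1) hp hq hne hbd one_ne_zero (h.congr fun z _ => by
      rw [zpow_one, zpow_neg_one, div_eq_mul_inv])
  · exact hbdd (-1) 1 hq hp (Ne.symm hne) hbd (by norm_num) (h.congr fun z _ => by
      rw [zpow_one, zpow_neg_one, div_eq_mul_inv, mul_comm])

theorem joinedIn_of_mem_connectedComponentIn {K : Set (ℝ × ℝ)} (hK : IsClosed K) {p q : ℝ × ℝ}
    (hq : q ∈ connectedComponentIn Kᶜ p) : JoinedIn Kᶜ p q := by
  have hp : p ∈ Kᶜ := connectedComponentIn_nonempty_iff.1 ⟨q, hq⟩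
  have := (hK.isOpen_compl.connectedComponentIn (x := p)).isConnected_iff_isPathConnected.1
    (isConnected_connectedComponentIn_iff.2 hp)
  exact (this.joinedIn p (mem_connectedComponentIn hp) q hq).mono (connectedComponentIn_subset _ _)

section Arc

variable {X : Set (ℝ × ℝ)} {γ : ℝ → ℝ × ℝ} {s t : ℝ}

theorem hasLogOn_arc_div (hst : s ≤ t) (hγ : ContinuousOn γ (Icc s t)) (hinj : InjOn γ (Icc s t))
    {p q : ℝ × ℝ} (hp : p ∉ γ '' Icc s t) (hq : q ∉ γ '' Icc s t) :
    HasLogOn (γ '' Icc s t) (fun z => (ζ z - ζ p) / (ζ z - ζ q)) := by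
  have h0 : ∀ {x : ℝ × ℝ}, x ∉ γ '' Icc s t → ∀ z ∈ γ '' Icc s t, ζ z - ζ x ≠ 0 :=
    fun hx z hz => planeToComplex_sub_ne_zero (ne_of_mem_of_not_mem hz hx)
  have hc : ∀ x, Continuous fun z => ζ z - ζ x := fun x =>
    continuous_planeToComplex.sub continuous_const
  exact hasLogOn_image_Icc hst hγ hinj ((hc p).continuousOn.div (hc q).continuousOn (h0 hq))
    fun z hz => div_ne_zero (h0 hp z hz) (h0 hq z hz)

/-- An arc meeting a compact set in a connected set does not separate the components of its
complement. -/
theorem connectedComponentIn_union_arc_eq (hX : IsCompact X) (hst : s ≤ t)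
    (hγ : ContinuousOn γ (Icc s t)) (hinj : InjOn γ (Icc s t))
    (hXγ : IsPreconnected (X ∩ γ '' Icc s t)) {p q : ℝ × ℝ} (hp : p ∉ γ '' Icc s t)
    (hq : q ∉ γ '' Icc s t) (hpq : q ∈ connectedComponentIn Xᶜ p) :
    connectedComponentIn (X ∪ γ '' Icc s t)ᶜ p = connectedComponentIn (X ∪ γ '' Icc s t)ᶜ q := by
  have hA : IsCompact (γ '' Icc s t) := isCompact_Icc.image_of_continuousOn hγ
  have hpX : p ∉ X := connectedComponentIn_nonempty_iff.1 ⟨q, hpq⟩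
  have hqX : q ∉ X := connectedComponentIn_subset _ _ hpq
  refine connectedComponentIn_eq_of_hasLogOn (hX.union hA) (by simp [hpX, hp])
    (by simp [hqX, hq]) ?_
  refine HasLogOn.union (Or.inr ⟨hX.isClosed, hA.isClosed⟩) ?_ (hasLogOn_arc_div hst hγ hinj hp hq)
    hXγ
  exact ((joinedIn_of_mem_connectedComponentIn hX.isClosed hpq).mono (by simp)).hasLogOn


theorem exists_log_pair_of_mem (hX : IsCompact X) (hst : s ≤ t)
    (hγ : ContinuousOn γ (Icc s t)) (hinj : InjOn γ (Icc s t)) (hs : γ s ∈ X) (ht : γ t ∈ X)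
    {p q : ℝ × ℝ} (hp : p ∉ γ '' Icc s t) (hq : q ∉ γ '' Icc s t)
    (hpq : q ∈ connectedComponentIn Xᶜ p) :
    ∃ (g h : ℝ × ℝ → ℂ) (n : ℤ), ContinuousOn g X ∧ ContinuousOn h (γ '' Icc s t) ∧
      (∀ z ∈ X, Complex.exp (g z) = (ζ z - ζ p) / (ζ z - ζ q)) ∧
      (∀ z ∈ γ '' Icc s t, Complex.exp (h z) = (ζ z - ζ p) / (ζ z - ζ q)) ∧
      g (γ s) = h (γ s) ∧ g (γ t) = h (γ t) + n * (2 * Real.pi * Complex.I) := by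
  obtain ⟨g, hg, hgφ⟩ :=
    ((joinedIn_of_mem_connectedComponentIn hX.isClosed hpq).mono (by simp) :
      JoinedIn Xᶜ p q).hasLogOn
  obtain ⟨h, hh, hhφ⟩ := hasLogOn_arc_div hst hγ hinj hp hq
  have key : ∀ r ∈ Icc s t, γ r ∈ X →
      ∃ n : ℤ, g (γ r) = h (γ r) + n * (2 * Real.pi * Complex.I) := fun r hr hrX =>
    Complex.exp_eq_exp_iff_exists_int.1
      ((hgφ _ hrX).trans (hhφ _ (mem_image_of_mem γ hr)).symm)
  obtain ⟨m, hm⟩ := key s (left_mem_Icc.2 hst) hs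
  obtain ⟨n, hn⟩ := key t (right_mem_Icc.2 hst) ht
  refine ⟨g, fun z => h z + m * (2 * Real.pi * Complex.I), n - m, hg,
    hh.add continuousOn_const, hgφ, fun z hz => ?_, hm, ?_⟩
  · simpa [Complex.exp_periodic.int_mul m (h z)] using hhφ z hz
  · rw [hn]
    push_cast
    ring

/-- A cross-arc splits a component of the complement of a compact set into at most two
components. -/
theorem connectedComponentIn_union_crossArc_eq (hX : IsCompact X) (hst : s ≤ t)
    (hγ : ContinuousOn γ (Icc s t)) (hinj : InjOn γ (Icc s t)) (hs : γ s ∈ X) (ht : γ t ∈ X)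
    (hXγ : X ∩ γ '' Icc s t ⊆ {γ s, γ t}) {p q r : ℝ × ℝ} (hp : p ∉ γ '' Icc s t)
    (hq : q ∉ γ '' Icc s t) (hr : r ∉ γ '' Icc s t) (hpq : q ∈ connectedComponentIn Xᶜ p)
    (hpr : r ∈ connectedComponentIn Xᶜ p) :
    connectedComponentIn (X ∪ γ '' Icc s t)ᶜ p = connectedComponentIn (X ∪ γ '' Icc s t)ᶜ q ∨
    connectedComponentIn (X ∪ γ '' Icc s t)ᶜ p = connectedComponentIn (X ∪ γ '' Icc s t)ᶜ r ∨
    connectedComponentIn (X ∪ γ '' Icc s t)ᶜ q = connectedComponentIn (X ∪ γ '' Icc s t)ᶜ r := by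
  have hA : IsCompact (γ '' Icc s t) := isCompact_Icc.image_of_continuousOn hγ
  have hclosed : (IsOpen X ∧ IsOpen (γ '' Icc s t)) ∨ (IsClosed X ∧ IsClosed (γ '' Icc s t)) :=
    Or.inr ⟨hX.isClosed, hA.isClosed⟩
  have hp' : p ∉ X ∪ γ '' Icc s t := by
    simp [show p ∉ X from connectedComponentIn_nonempty_iff.1 ⟨q, hpq⟩, hp]
  have hq' : q ∉ X ∪ γ '' Icc s t := by
    simp [show q ∉ X from connectedComponentIn_subset _ _ hpq, hq]
  have hr' : r ∉ X ∪ γ '' Icc s t := by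
    simp [show r ∉ X from connectedComponentIn_subset _ _ hpr, hr]
  by_contra! hne
  obtain ⟨hne1, hne2, hne3⟩ := hne
  obtain ⟨g, h, m, hg, hh, hgφ, hhφ, hs1, ht1⟩ :=
    exists_log_pair_of_mem hX hst hγ hinj hs ht hp hq hpq
  obtain ⟨g', h', n, hg', hh', hgφ', hhφ', hs2, ht2⟩ :=
    exists_log_pair_of_mem hX hst hγ hinj hs ht hp hr hpr
  have hm : m ≠ 0 := by
    rintro rfl
    refine hne1 (connectedComponentIn_eq_of_hasLogOn (hX.union hA) hp' hq'
      (HasLogOn.union_of_eq hclosed hg hh hgφ hhφ 0 fun z hz => ?_))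
    rcases hXγ hz with rfl | rfl
    · simp [hs1]
    · simp [ht1]
  have hn : n ≠ 0 := by
    rintro rfl
    refine hne2 (connectedComponentIn_eq_of_hasLogOn (hX.union hA) hp' hr'
      (HasLogOn.union_of_eq hclosed hg' hh' hgφ' hhφ' 0 fun z hz => ?_))
    rcases hXγ hz with rfl | rfl
    · simp [hs2]
    · simp [ht2]
  refine not_hasLogOn_of_ne (hX.union hA) hq' hr' hp' hne3 hne1.symm hne2.symm (neg_ne_zero.2 hn) hm
    (n - m) (HasLogOn.congr (φ := fun z => ((ζ z - ζ p) / (ζ z - ζ q)) ^ n *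
      (((ζ z - ζ p) / (ζ z - ζ r)) ^ m)⁻¹) ?_ fun z hz => ?_)
  · refine HasLogOn.union_of_eq (g := fun z => n * g z - m * g' z)
      (k := fun z => n * h z - m * h' z) hclosed
      ((continuousOn_const.mul hg).sub (continuousOn_const.mul hg'))
      ((continuousOn_const.mul hh).sub (continuousOn_const.mul hh')) (fun z hz => ?_)
      (fun z hz => ?_) 0 fun z hz => ?_
    · rw [Complex.exp_sub, Complex.exp_int_mul, Complex.exp_int_mul, hgφ z hz, hgφ' z hz,
        div_eq_mul_inv]
    · rw [Complex.exp_sub, Complex.exp_int_mul, Complex.exp_int_mul, hhφ z hz, hhφ' z hz,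
        div_eq_mul_inv]
    · rcases hXγ hz with rfl | rfl
      · simp [hs1, hs2]
      · simp only [ht1, ht2, Int.cast_zero]
        ring
  · have h1 := planeToComplex_sub_ne_zero (ne_of_mem_of_not_mem hz hp')
    simp only [div_zpow, zpow_sub₀ h1, zpow_neg, inv_div]
    field_simp

/-- A cross-arc of a path connected set separates the component of the complement containing it. -/
theorem not_isPreconnected_diff_crossArc (hX : IsClosed X) (hXc : IsPathConnected X)
    (hst : s < t) (hγ : ContinuousOn γ (Icc s t)) (hinj : InjOn γ (Icc s t)) (hs : γ s ∈ X)
    (ht : γ t ∈ X) {p : ℝ × ℝ} (hp : γ '' Ioo s t ⊆ connectedComponentIn Xᶜ p) :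
    ¬ IsPreconnected (connectedComponentIn Xᶜ p \ γ '' Icc s t) := by
  intro hcon
  set Ω := connectedComponentIn Xᶜ p with hΩ
  have hΩo : IsOpen Ω := hX.isOpen_compl.connectedComponentIn
  have hΩX : Ω ⊆ Xᶜ := connectedComponentIn_subset _ _
  obtain ⟨c, hsc, hct⟩ := exists_between hst
  have hcΩ : γ c ∈ Ω := hp (mem_image_of_mem γ ⟨hsc, hct⟩)
  have hsub1 : Icc s c ⊆ Icc s t := Icc_subset_Icc_right hct.le
  have hsub2 : Icc c t ⊆ Icc s t := Icc_subset_Icc_left hsc.le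
  have hpath : ∀ {a b : ℝ}, a ≤ b → Icc a b ⊆ Icc s t → IsPathConnected (γ '' Icc a b) :=
    fun hab hsub => ((convex_Icc _ _).isPathConnected (nonempty_Icc.2 hab)).image' (hγ.mono hsub)
  have hclosed : ∀ {a b : ℝ}, Icc a b ⊆ Icc s t → IsClosed (γ '' Icc a b) :=
    fun hsub => (isCompact_Icc.image_of_continuousOn (hγ.mono hsub)).isClosed
  have hlog1 : HasLogOn (Ω \ γ '' Icc s c) (fun z => (ζ z - ζ (γ c)) / (ζ z - ζ (γ s))) :=
    (hpath hsc.le hsub1).hasLogOn disjoint_sdiff_right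
      (mem_image_of_mem γ (right_mem_Icc.2 hsc.le)) (mem_image_of_mem γ (left_mem_Icc.2 hsc.le))
  have hlog2 : HasLogOn (Ω \ γ '' Icc c t) (fun z => (ζ z - ζ (γ c)) / (ζ z - ζ (γ s))) := by
    have h1 : HasLogOn (Ω \ γ '' Icc c t) (fun z => (ζ z - ζ (γ c)) / (ζ z - ζ (γ t))) :=
      (hpath hct.le hsub2).hasLogOn disjoint_sdiff_right
        (mem_image_of_mem γ (left_mem_Icc.2 hct.le)) (mem_image_of_mem γ (right_mem_Icc.2 hct.le))
    have h2 : HasLogOn (Ω \ γ '' Icc c t) (fun z => (ζ z - ζ (γ t)) / (ζ z - ζ (γ s))) :=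
      hXc.hasLogOn (disjoint_left.2 fun x hx hx' => hΩX hx'.1 hx) ht hs
    refine (h1.mul h2).congr fun z hz => ?_
    have h3 : ζ z - ζ (γ t) ≠ 0 :=
      planeToComplex_sub_ne_zero (ne_of_mem_of_not_mem ht (hΩX hz.1)).symm
    exact div_mul_div_cancel₀ h3
  have hinter : (Ω \ γ '' Icc s c) ∩ (Ω \ γ '' Icc c t) = Ω \ γ '' Icc s t := by
    rw [← Icc_union_Icc_eq_Icc hsc.le hct.le, image_union]
    ext z
    simp only [mem_inter_iff, mem_sdiff, mem_union]
    tauto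
  have hlog := HasLogOn.union (Or.inl ⟨hΩo.sdiff (hclosed hsub1), hΩo.sdiff (hclosed hsub2)⟩)
    hlog1 hlog2 (hinter ▸ hcon)
  obtain ⟨ε, hε, hball⟩ := Metric.isOpen_iff.1 hΩo _ hcΩ
  have hlog3 : HasLogOn (Metric.ball (γ c) ε) (fun z => (ζ z - ζ (γ s))) := by
    have := (convex_ball (γ c) ε).contractibleSpace (Metric.nonempty_ball.2 hε)
    obtain ⟨f, hf, hfφ⟩ := Complex.exists_continuousOn_eqOn_exp_comp
      (g := fun z => ζ z - ζ (γ s)) (U := Metric.ball (γ c) ε)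
      (inferInstanceAs (SimplyConnectedSpace (Metric.ball (γ c) ε))) Metric.isOpen_ball
      (continuous_planeToComplex.sub continuous_const).continuousOn (by
        rintro ⟨z, hz, h0⟩
        exact planeToComplex_sub_ne_zero (ne_of_mem_of_not_mem hs (hΩX (hball hz))).symm h0)
    exact ⟨f, hf, fun z hz => hfφ hz⟩
  have hbound : ∀ z, ‖ζ z - ζ (γ c)‖ = ε / 2 → z ∈ Metric.ball (γ c) ε := fun z hz => by
    rw [mem_ball_iff_norm]
    have h1 : ζ z - ζ (γ c) = Complex.equivRealProdCLM.symm (z - γ c) := by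
      simp [planeToComplex]
    have h2 := Complex.equivRealProd_apply_le (ζ z - ζ (γ c))
    have h3 : Complex.equivRealProd (ζ z - ζ (γ c)) = z - γ c := by
      rw [h1]
      exact Complex.equivRealProdCLM.apply_symm_apply _
    rw [h3, hz] at h2
    linarith
  refine not_hasLogOn_circle (p := γ c) (half_pos hε) one_ne_zero
    (((hlog.mono fun z hz => ?_).mul (hlog3.mono hbound)).congr fun z hz => ?_)
  · have hzΩ := hball (hbound z hz)
    by_contra hcon'
    rw [mem_union, not_or] at hcon'
    have h1 : z ∈ γ '' Icc s c := by_contra fun h => hcon'.1 ⟨hzΩ, h⟩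
    have h2 : z ∈ γ '' Icc c t := by_contra fun h => hcon'.2 ⟨hzΩ, h⟩
    obtain ⟨a, ha, rfl⟩ := h1
    obtain ⟨b, hb, hab⟩ := h2
    have hba := hinj (hsub2 hb) (hsub1 ha) hab
    have hac : a = c := le_antisymm ha.2 (hba ▸ hb.1)
    subst hac
    have hz' : ‖ζ (γ a) - ζ (γ a)‖ = ε / 2 := hz
    rw [sub_self, norm_zero] at hz'
    linarith
  · have h3 : ζ z - ζ (γ s) ≠ 0 :=
      planeToComplex_sub_ne_zero (ne_of_mem_of_not_mem hs (hΩX (hball (hbound z hz)))).symm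
    rw [zpow_one]
    exact div_mul_cancel₀ _ h3

end Arc

section Face

variable {D D' f g U Ω : Set (ℝ × ℝ)} {z : ℝ × ℝ}

theorem isFaceOf_connectedComponentIn (hz : z ∉ D) : IsFaceOf D (connectedComponentIn Dᶜ z) :=
  ⟨z, hz, rfl⟩

theorem IsFaceOf.isOpen (hf : IsFaceOf D f) (hD : IsClosed D) : IsOpen f := by
  obtain ⟨z, -, rfl⟩ := hf
  exact hD.isOpen_compl.connectedComponentIn

theorem IsFaceOf.nonempty (hf : IsFaceOf D f) : f.Nonempty := by
  obtain ⟨z, hz, rfl⟩ := hf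
  exact ⟨z, mem_connectedComponentIn hz⟩

theorem IsFaceOf.isPreconnected (hf : IsFaceOf D f) : IsPreconnected f := by
  obtain ⟨z, -, rfl⟩ := hf
  exact isPreconnected_connectedComponentIn

theorem IsFaceOf.subset_compl (hf : IsFaceOf D f) : f ⊆ Dᶜ := by
  obtain ⟨z, -, rfl⟩ := hf
  exact connectedComponentIn_subset _ _

theorem IsFaceOf.eq_connectedComponentIn (hf : IsFaceOf D f) (hz : z ∈ f) :
    f = connectedComponentIn Dᶜ z := by
  obtain ⟨w, -, rfl⟩ := hf
  exact connectedComponentIn_eq hz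

theorem IsFaceOf.eq_of_mem (hf : IsFaceOf D f) (hg : IsFaceOf D g) (hzf : z ∈ f) (hzg : z ∈ g) :
    f = g :=
  (hf.eq_connectedComponentIn hzf).trans (hg.eq_connectedComponentIn hzg).symm

theorem IsFaceOf.subset_of_isPreconnected (hf : IsFaceOf D f) (hzf : z ∈ f) {T : Set (ℝ × ℝ)}
    (hT : IsPreconnected T) (hTD : Disjoint T D) (hzT : z ∈ T) : T ⊆ f := by
  rw [hf.eq_connectedComponentIn hzf]
  exact hT.subset_connectedComponentIn hzT hTD.subset_compl_right

theorem IsFaceOf.frontier_subset (hf : IsFaceOf D f) (hD : IsClosed D) : frontier f ⊆ D := by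
  obtain ⟨z, -, rfl⟩ := hf
  exact frontier_connectedComponentIn_subset hD z

/-- A face of a drawing which avoids a larger drawing is a face of the larger drawing. -/
theorem IsFaceOf.of_disjoint (hf : IsFaceOf D f) (hDD' : D ⊆ D') (h : Disjoint f D') :
    IsFaceOf D' f := by
  obtain ⟨z, hz⟩ := hf.nonempty
  have hz' := disjoint_left.1 h hz
  refine ⟨z, hz', subset_antisymm
    (hf.isPreconnected.subset_connectedComponentIn hz h.subset_compl_right)
    (hf.subset_of_isPreconnected hz isPreconnected_connectedComponentIn ?_
      (mem_connectedComponentIn hz'))⟩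
  exact (subset_compl_iff_disjoint_right.1 (connectedComponentIn_subset _ _)).mono_right hDD'

/-- Enlarging a drawing only inside one face keeps the other faces. -/
theorem IsFaceOf.of_diff_subset (hf : IsFaceOf D f) (hΩ : IsFaceOf D Ω) (hDD' : D ⊆ D')
    (hD' : D' \ D ⊆ Ω) (hne : f ≠ Ω) : IsFaceOf D' f := by
  refine hf.of_disjoint hDD' (disjoint_left.2 fun z hz hz' => hne ?_)
  exact hf.eq_of_mem hΩ hz (hD' ⟨hz', hf.subset_compl hz⟩)

/-- If a drawing is enlarged only inside one face, then every face of the larger drawing which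
is not contained in that face is a face of the original drawing. -/
theorem IsFaceOf.of_not_subset (hf : IsFaceOf D' f) (hΩ : IsFaceOf D Ω) (hDD' : D ⊆ D')
    (hD' : D' \ D ⊆ Ω) (hne : ¬ f ⊆ Ω) : IsFaceOf D f := by
  obtain ⟨z, hz⟩ := hf.nonempty
  have hzD : z ∉ D := fun h => hf.subset_compl hz (hDD' h)
  have hg := isFaceOf_connectedComponentIn hzD
  have hfg : f ⊆ connectedComponentIn Dᶜ z := hf.isPreconnected.subset_connectedComponentIn hz
    (hf.subset_compl.trans (compl_subset_compl.2 hDD'))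
  have hg' := hg.of_diff_subset hΩ hDD' hD' fun h => hne (h ▸ hfg)
  rwa [hf.eq_of_mem hg' hz (mem_connectedComponentIn hzD)]

/-- The faces of `D` contained in the region `U`. -/
def facesIn (D U : Set (ℝ × ℝ)) : Set (Set (ℝ × ℝ)) :=
  {f | IsFaceOf D f ∧ f ⊆ U}

theorem facesIn_self (hΩ : IsFaceOf D Ω) : facesIn D Ω = {Ω} := by
  refine eq_singleton_iff_unique_mem.2 ⟨⟨hΩ, subset_rfl⟩, fun f hf => ?_⟩
  obtain ⟨z, hz⟩ := hf.1.nonempty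
  exact hf.1.eq_of_mem hΩ hz (hf.2 hz)

theorem encard_facesIn_of_diff_subset (hΩ : IsFaceOf D Ω) (hΩU : Ω ⊆ U) (hDD' : D ⊆ D')
    (hD' : D' \ D ⊆ Ω) {k : ℕ∞} (hk : (facesIn D' Ω).encard = k + 1) :
    (facesIn D' U).encard = (facesIn D U).encard + k := by
  have h1 : facesIn D' U = (facesIn D U \ {Ω}) ∪ facesIn D' Ω := by
    ext f
    constructor
    · rintro ⟨hf, hfU⟩
      by_cases h : f ⊆ Ω
      · exact Or.inr ⟨hf, h⟩
      · exact Or.inl ⟨⟨hf.of_not_subset hΩ hDD' hD' h, hfU⟩, fun h' => h (h' ▸ subset_rfl)⟩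
    · rintro (⟨⟨hf, hfU⟩, hne⟩ | ⟨hf, hfΩ⟩)
      · exact ⟨hf.of_diff_subset hΩ hDD' hD' hne, hfU⟩
      · exact ⟨hf, hfΩ.trans hΩU⟩
  have h2 : Disjoint (facesIn D U \ {Ω}) (facesIn D' Ω) := by
    rw [disjoint_left]
    rintro f ⟨⟨hf, -⟩, hne⟩ ⟨-, hfΩ⟩
    obtain ⟨z, hz⟩ := hf.nonempty
    exact hne (hf.eq_of_mem hΩ hz (hfΩ hz))
  rw [h1, encard_union_eq h2, hk, ← encard_sdiff_singleton_add_one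
    (show Ω ∈ facesIn D U from ⟨hΩ, hΩU⟩), add_assoc, add_comm 1 k]

end Face

section FaceArc

variable {X U Ω : Set (ℝ × ℝ)} {γ : ℝ → ℝ × ℝ} {s t : ℝ}

/-- Removing an arc attached to a drawing by a connected set from a face leaves a face. -/
theorem IsFaceOf.diff_arc (hX : IsCompact X) (hΩ : IsFaceOf X Ω) (hst : s ≤ t)
    (hγ : ContinuousOn γ (Icc s t)) (hinj : InjOn γ (Icc s t))
    (hXγ : IsPreconnected (X ∩ γ '' Icc s t)) (hne : (Ω \ γ '' Icc s t).Nonempty) :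
    IsFaceOf (X ∪ γ '' Icc s t) (Ω \ γ '' Icc s t) := by
  obtain ⟨p, hpΩ, hp⟩ := hne
  have hpXA : p ∉ X ∪ γ '' Icc s t := fun h => h.elim (hΩ.subset_compl hpΩ) hp
  refine ⟨p, hpXA, subset_antisymm (fun q hq => ?_) fun q hq => ⟨?_, ?_⟩⟩
  · have hq' : q ∉ X ∪ γ '' Icc s t := fun h => h.elim (hΩ.subset_compl hq.1) hq.2
    rw [connectedComponentIn_union_arc_eq hX hst hγ hinj hXγ hp hq.2
      (hΩ.eq_connectedComponentIn hpΩ ▸ hq.1)]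
    exact mem_connectedComponentIn hq'
  · rw [hΩ.eq_connectedComponentIn hpΩ]
    exact connectedComponentIn_mono _ (compl_subset_compl.2 subset_union_left) hq
  · exact fun h => connectedComponentIn_subset _ _ hq (Or.inr h)

theorem encard_facesIn_union_arc (hX : IsCompact X) (hΩ : IsFaceOf X Ω) (hΩU : Ω ⊆ U)
    (hst : s ≤ t) (hγ : ContinuousOn γ (Icc s t)) (hinj : InjOn γ (Icc s t))
    (hXγ : IsPreconnected (X ∩ γ '' Icc s t)) (hne : (Ω \ γ '' Icc s t).Nonempty)
    (hsub : γ '' Icc s t \ X ⊆ Ω) :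
    (facesIn (X ∪ γ '' Icc s t) U).encard = (facesIn X U).encard := by
  rw [← add_zero (facesIn X U).encard]
  refine encard_facesIn_of_diff_subset hΩ hΩU subset_union_left
    (union_sdiff_left.subset.trans hsub) ?_
  rw [zero_add, encard_eq_one]
  have hf := hΩ.diff_arc hX hst hγ hinj hXγ hne
  refine ⟨_, eq_singleton_iff_unique_mem.2 ⟨⟨hf, sdiff_subset⟩, fun g hg => ?_⟩⟩
  obtain ⟨z, hz⟩ := hg.1.nonempty
  exact hg.1.eq_of_mem hf hz ⟨hg.2 hz, fun h => hg.1.subset_compl hz (Or.inr h)⟩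

theorem encard_facesIn_union_crossArc (hX : IsCompact X) (hXc : IsPathConnected X)
    (hΩ : IsFaceOf X Ω) (hΩU : Ω ⊆ U) (hst : s < t) (hγ : ContinuousOn γ (Icc s t))
    (hinj : InjOn γ (Icc s t)) (hs : γ s ∈ X) (ht : γ t ∈ X) (hΩγ : γ '' Ioo s t ⊆ Ω) :
    (facesIn (X ∪ γ '' Icc s t) U).encard = (facesIn X U).encard + 1 := by
  have hA : γ '' Icc s t ⊆ {γ s, γ t} ∪ γ '' Ioo s t := by
    rintro _ ⟨r, hr, rfl⟩
    rcases eq_endpoints_or_mem_Ioo_of_mem_Icc hr with rfl | rfl | h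
    · simp
    · simp
    · exact Or.inr (mem_image_of_mem γ h)
  have hsub : γ '' Icc s t \ X ⊆ Ω := by
    rintro z ⟨hz, hzX⟩
    rcases hA hz with (rfl | rfl) | h
    · exact absurd hs hzX
    · exact absurd ht hzX
    · exact hΩγ h
  have hXγ : X ∩ γ '' Icc s t ⊆ {γ s, γ t} := by
    rintro z ⟨hzX, hz⟩
    exact (hA hz).resolve_right fun h => hΩ.subset_compl (hΩγ h) hzX
  refine encard_facesIn_of_diff_subset hΩ hΩU subset_union_left
    (union_sdiff_left.subset.trans hsub) ?_
  have hface : ∀ {z}, z ∈ Ω \ γ '' Icc s t →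
      connectedComponentIn (X ∪ γ '' Icc s t)ᶜ z ∈ facesIn (X ∪ γ '' Icc s t) Ω := by
    rintro z ⟨hz, hzA⟩
    refine ⟨isFaceOf_connectedComponentIn fun h => h.elim (hΩ.subset_compl hz) hzA, ?_⟩
    conv_rhs => rw [hΩ.eq_connectedComponentIn hz]
    exact connectedComponentIn_mono _ (compl_subset_compl.2 subset_union_left)
  have hmem : ∀ {z}, z ∈ Ω \ γ '' Icc s t →
      z ∈ connectedComponentIn (X ∪ γ '' Icc s t)ᶜ z := fun hz =>
    mem_connectedComponentIn fun h => h.elim (hΩ.subset_compl hz.1) hz.2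
  have hnot : ¬ IsPreconnected (Ω \ γ '' Icc s t) := by
    obtain ⟨p, -, rfl⟩ := hΩ
    exact not_isPreconnected_diff_crossArc hX.isClosed hXc hst hγ hinj hs ht hΩγ
  have hface' : ∀ {f}, f ∈ facesIn (X ∪ γ '' Icc s t) Ω → ∃ z ∈ Ω \ γ '' Icc s t,
      f = connectedComponentIn (X ∪ γ '' Icc s t)ᶜ z := fun {f} hf => by
    obtain ⟨z, hz⟩ := hf.1.nonempty
    exact ⟨z, ⟨hf.2 hz, fun h => hf.1.subset_compl hz (Or.inr h)⟩,
      hf.1.eq_connectedComponentIn hz⟩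
  obtain ⟨f, hf, g, hg, hfg⟩ : (facesIn (X ∪ γ '' Icc s t) Ω).Nontrivial := by
    by_contra hcon
    refine hnot (isPreconnected_of_forall_pair fun a ha b hb => ?_)
    have hab := not_nontrivial_iff.1 hcon (hface ha) (hface hb)
    refine ⟨_, fun z hz => ⟨(hface ha).2 hz, fun h => ?_⟩, hmem ha, hab ▸ hmem hb,
      isPreconnected_connectedComponentIn⟩
    exact connectedComponentIn_subset _ _ hz (Or.inr h)
  rw [one_add_one_eq_two, encard_eq_two]
  refine ⟨f, g, hfg, subset_antisymm (fun h hh => ?_) ?_⟩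
  · obtain ⟨p, hp, rfl⟩ := hface' hf
    obtain ⟨q, hq, rfl⟩ := hface' hg
    obtain ⟨r, hr, rfl⟩ := hface' hh
    have h1 := hΩ.eq_connectedComponentIn hp.1
    rcases connectedComponentIn_union_crossArc_eq hX hst.le hγ hinj hs ht hXγ hp.2 hq.2 hr.2
      (h1 ▸ hq.1) (h1 ▸ hr.1) with h | h | h
    · exact absurd h hfg
    · exact Or.inl h.symm
    · exact Or.inr h.symm
  · rintro _ (rfl | rfl)
    exacts [hf, hg]

end FaceArc

/-- Three arcs joining the point `v` to the set `X` which pairwise meet only in `v` and meet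
`X` only in their other ends. -/
structure IsTripod (X : Set (ℝ × ℝ)) (v : ℝ × ℝ) (γ : Fin 3 → ℝ → ℝ × ℝ) : Prop where
  continuousOn : ∀ i, ContinuousOn (γ i) (Icc 0 1)
  injOn : ∀ i, InjOn (γ i) (Icc 0 1)
  map_zero : ∀ i, γ i 0 = v
  map_one_mem : ∀ i, γ i 1 ∈ X
  notMem : ∀ i, ∀ t ∈ Ico (0 : ℝ) 1, γ i t ∉ X
  eq_zero : ∀ i j, i ≠ j → ∀ s ∈ Icc (0 : ℝ) 1, ∀ t ∈ Icc (0 : ℝ) 1, γ i s = γ j t → s = 0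

/-- The union of `X` and the final segments, starting at time `a`, of three arcs. -/
def withArcs (X : Set (ℝ × ℝ)) (γ : Fin 3 → ℝ → ℝ × ℝ) (a : ℝ) : Set (ℝ × ℝ) :=
  X ∪ γ 0 '' Icc a 1 ∪ γ 1 '' Icc a 1 ∪ γ 2 '' Icc a 1

namespace IsTripod

variable {X U Ω f : Set (ℝ × ℝ)} {v : ℝ × ℝ} {γ : Fin 3 → ℝ → ℝ × ℝ}

theorem mem_withArcs {a : ℝ} {z : ℝ × ℝ} :
    z ∈ withArcs X γ a ↔ z ∈ X ∨ ∃ i, z ∈ γ i '' Icc a 1 := by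
  simp [withArcs, Fin.exists_fin_succ, or_assoc]

theorem subset_face (h : IsTripod X v γ) (hΩ : IsFaceOf X Ω) (hv : v ∈ Ω) (i : Fin 3) :
    γ i '' Ico 0 1 ⊆ Ω := by
  have h0 : (0 : ℝ) ∈ Ico (0 : ℝ) 1 := by simp
  refine hΩ.subset_of_isPreconnected hv
    (isPreconnected_Ico.image _ ((h.continuousOn i).mono Ico_subset_Icc_self)) ?_
    ⟨0, h0, h.map_zero i⟩
  rw [disjoint_left]
  rintro _ ⟨t, ht, rfl⟩
  exact h.notMem i t ht

theorem inter_arc (h : IsTripod X v γ) (i : Fin 3) {a : ℝ} (ha : 0 ≤ a) :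
    X ∩ γ i '' Icc a 1 ⊆ {γ i 1} := by
  rintro _ ⟨hzX, t, ht, rfl⟩
  rcases ht.2.eq_or_lt with rfl | h1
  · rfl
  · exact absurd hzX (h.notMem i t ⟨ha.trans ht.1, h1⟩)

theorem notMem_arc (h : IsTripod X v γ) {i j : Fin 3} (hij : i ≠ j) {s : ℝ} (hs0 : 0 < s)
    (hs1 : s ≤ 1) {a : ℝ} (ha : 0 ≤ a) : γ i s ∉ γ j '' Icc a 1 := by
  rintro ⟨t, ht, hts⟩
  exact hs0.ne' (h.eq_zero i j hij s ⟨hs0.le, hs1⟩ t ⟨ha.trans ht.1, ht.2⟩ hts.symm)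

theorem notMem_image_Icc (h : IsTripod X v γ) (i : Fin 3) {a : ℝ} (ha : 0 < a) :
    v ∉ γ i '' Icc a 1 := by
  rintro ⟨t, ht, htv⟩
  have := h.injOn i (Icc_subset_Icc_left ha.le ht) (left_mem_Icc.2 zero_le_one)
    (htv.trans (h.map_zero i).symm)
  exact ha.not_ge (this ▸ ht.1)

theorem exists_face_of_disjoint (h : IsTripod X v γ) (hΩ : IsFaceOf X Ω) (hv : v ∈ Ω)
    (i : Fin 3) {D : Set (ℝ × ℝ)} (hXD : X ⊆ D) (hD : Disjoint (γ i '' Ioo 0 1) D) :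
    ∃ Ω', IsFaceOf D Ω' ∧ Ω' ⊆ Ω ∧ γ i '' Ioo 0 1 ⊆ Ω' := by
  have hmem : γ i (1 / 2) ∈ γ i '' Ioo 0 1 := ⟨1 / 2, by norm_num, rfl⟩
  have hD' := disjoint_left.1 hD hmem
  refine ⟨_, isFaceOf_connectedComponentIn hD', ?_, ?_⟩
  · rw [hΩ.eq_connectedComponentIn (h.subset_face hΩ hv i ⟨1 / 2, by norm_num, rfl⟩)]
    exact connectedComponentIn_mono _ (compl_subset_compl.2 hXD)
  · exact (isPreconnected_Ioo.image _ ((h.continuousOn i).mono Ioo_subset_Icc_self)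
      ).subset_connectedComponentIn hmem hD.subset_compl_right

theorem isCompact_arc (h : IsTripod X v γ) (i : Fin 3) : IsCompact (γ i '' Icc 0 1) :=
  isCompact_Icc.image_of_continuousOn (h.continuousOn i)

theorem isPathConnected_arc (h : IsTripod X v γ) (i : Fin 3) :
    IsPathConnected (γ i '' Icc 0 1) :=
  ((convex_Icc _ _).isPathConnected (nonempty_Icc.2 zero_le_one)).image' (h.continuousOn i)

theorem encard_facesIn (h : IsTripod X v γ) (hX : IsCompact X) (hXc : IsPathConnected X)
    (hΩ : IsFaceOf X Ω) (hv : v ∈ Ω) (hΩU : Ω ⊆ U) :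
    (facesIn (withArcs X γ 0) U).encard = (facesIn X U).encard + 2 := by
  have hv' : ∀ i, v ∈ γ i '' Icc 0 1 := fun i => ⟨0, by simp, h.map_zero i⟩
  have hone : ∀ i, γ i 1 ∈ γ i '' Icc 0 1 := fun i => ⟨1, by simp, rfl⟩
  have hdisj : ∀ {i j}, i ≠ j → Disjoint (γ i '' Ioo 0 1) (γ j '' Icc 0 1) := fun hij => by
    rw [disjoint_left]
    rintro _ ⟨t, ht, rfl⟩
    exact h.notMem_arc hij ht.1 ht.2.le le_rfl
  have hdisjX : ∀ i, Disjoint (γ i '' Ioo 0 1) X := fun i => by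
    rw [disjoint_left]
    rintro _ ⟨t, ht, rfl⟩
    exact h.notMem i t ⟨ht.1.le, ht.2⟩
  have hX0c : IsPathConnected (X ∪ γ 0 '' Icc 0 1) :=
    hXc.union (h.isPathConnected_arc 0) ⟨γ 0 1, h.map_one_mem 0, hone 0⟩
  have hX1c : IsPathConnected (X ∪ γ 0 '' Icc 0 1 ∪ γ 1 '' Icc 0 1) :=
    hX0c.union (h.isPathConnected_arc 1) ⟨v, Or.inr (hv' 0), hv' 1⟩
  have hX0 := hX.union (h.isCompact_arc 0)
  have hX1 := hX0.union (h.isCompact_arc 1)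
  obtain ⟨Ω₁, hΩ₁, hΩ₁Ω, hsub₁⟩ := h.exists_face_of_disjoint hΩ hv 1
    (D := X ∪ γ 0 '' Icc 0 1) subset_union_left
    (disjoint_union_right.2 ⟨hdisjX 1, hdisj (by decide)⟩)
  obtain ⟨Ω₂, hΩ₂, hΩ₂Ω, hsub₂⟩ := h.exists_face_of_disjoint hΩ hv 2
    (D := X ∪ γ 0 '' Icc 0 1 ∪ γ 1 '' Icc 0 1) (subset_union_left.trans subset_union_left)
    (disjoint_union_right.2 ⟨disjoint_union_right.2 ⟨hdisjX 2, hdisj (by decide)⟩,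
      hdisj (by decide)⟩)
  rw [withArcs, encard_facesIn_union_crossArc hX1 hX1c hΩ₂ (hΩ₂Ω.trans hΩU) one_pos
      (h.continuousOn 2) (h.injOn 2) (by rw [h.map_zero]; exact Or.inr (hv' 1))
      (Or.inl (Or.inl (h.map_one_mem 2))) hsub₂,
    encard_facesIn_union_crossArc hX0 hX0c hΩ₁ (hΩ₁Ω.trans hΩU) one_pos
      (h.continuousOn 1) (h.injOn 1) (by rw [h.map_zero]; exact Or.inr (hv' 0))
      (Or.inl (h.map_one_mem 1)) hsub₁,
    encard_facesIn_union_arc hX hΩ hΩU zero_le_one (h.continuousOn 0) (h.injOn 0)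
      (subsingleton_singleton.anti (h.inter_arc 0 le_rfl)).isPreconnected, add_assoc,
    one_add_one_eq_two]
  · exact ⟨γ 1 (1 / 2), h.subset_face hΩ hv 1 ⟨1 / 2, by norm_num, rfl⟩,
      h.notMem_arc (by decide) (by norm_num) (by norm_num) le_rfl⟩
  · rintro _ ⟨⟨t, ht, rfl⟩, htX⟩
    rcases ht.2.eq_or_lt with rfl | h1
    · exact absurd (h.map_one_mem 0) htX
    · exact h.subset_face hΩ hv 0 ⟨t, ⟨ht.1, h1⟩, rfl⟩

theorem isFaceOf_diff (h : IsTripod X v γ) (hX : IsCompact X) (hΩ : IsFaceOf X Ω) (hv : v ∈ Ω)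
    {a : ℝ} (ha : 0 < a) (ha1 : a ≤ 1) :
    IsFaceOf (withArcs X γ a)
      (((Ω \ γ 0 '' Icc a 1) \ γ 1 '' Icc a 1) \ γ 2 '' Icc a 1) := by
  have hsub : Icc a 1 ⊆ Icc 0 1 := Icc_subset_Icc_left ha.le
  have hc : ∀ i, ContinuousOn (γ i) (Icc a 1) := fun i => (h.continuousOn i).mono hsub
  have hi : ∀ i, InjOn (γ i) (Icc a 1) := fun i => (h.injOn i).mono hsub
  have hcomp : ∀ i, IsCompact (γ i '' Icc a 1) := fun i =>
    isCompact_Icc.image_of_continuousOn (hc i)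
  have hv' : ∀ i, v ∉ γ i '' Icc a 1 := fun i => h.notMem_image_Icc i ha
  have hdisj : ∀ {i j}, i ≠ j → γ i '' Icc a 1 ∩ γ j '' Icc a 1 = ∅ := fun {i j} hij => by
    rw [← disjoint_iff_inter_eq_empty, disjoint_left]
    rintro _ ⟨t, ht, rfl⟩
    exact h.notMem_arc hij (ha.trans_le ht.1) ht.2 ha.le
  have hX0 := hX.union (hcomp 0)
  have hX1 := hX0.union (hcomp 1)
  have hpre : ∀ i, IsPreconnected (X ∩ γ i '' Icc a 1) := fun i =>
    (subsingleton_singleton.anti (h.inter_arc i ha.le)).isPreconnected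
  refine ((hΩ.diff_arc hX ha1 (hc 0) (hi 0) (hpre 0) ⟨v, hv, hv' 0⟩).diff_arc hX0 ha1 (hc 1)
    (hi 1) ?_ ⟨v, ⟨hv, hv' 0⟩, hv' 1⟩).diff_arc hX1 ha1 (hc 2) (hi 2) ?_
    ⟨v, ⟨⟨hv, hv' 0⟩, hv' 1⟩, hv' 2⟩
  · rw [union_inter_distrib_right, hdisj (by decide), union_empty]
    exact hpre 1
  · rw [union_inter_distrib_right, union_inter_distrib_right, hdisj (by decide),
      hdisj (by decide), union_empty, union_empty]
    exact hpre 2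

theorem exists_forall_notMem (h : IsTripod X v γ) {K : Set (ℝ × ℝ)} (hK : IsClosed K)
    (hv : v ∉ K) : ∃ a : ℝ, 0 < a ∧ a ≤ 1 ∧ ∀ i, ∀ t ∈ Ico 0 a, γ i t ∉ K := by
  have key : ∀ i, ∃ a : ℝ, 0 < a ∧ a ≤ 1 ∧ ∀ t ∈ Ico 0 a, γ i t ∉ K := fun i => by
    have h1 := (h.continuousOn i) 0 (left_mem_Icc.2 zero_le_one)
    have h2 := h1.preimage_mem_nhdsWithin (hK.isOpen_compl.mem_nhds ((h.map_zero i).symm ▸ hv))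
    obtain ⟨δ, hδ, hsub⟩ := Metric.mem_nhdsWithin_iff.1 h2
    refine ⟨min δ 1, lt_min hδ one_pos, min_le_right _ _, fun t ht => hsub ⟨?_, ht.1, ?_⟩⟩
    · rw [Metric.mem_ball, Real.dist_eq, sub_zero, abs_of_nonneg ht.1]
      exact ht.2.trans_le (min_le_left _ _)
    · exact (ht.2.trans_le (min_le_right _ _)).le
  choose a ha ha1 haK using key
  refine ⟨min (a 0) (min (a 1) (a 2)), lt_min (ha 0) (lt_min (ha 1) (ha 2)),
    (min_le_left _ _).trans (ha1 0), fun i t ht => haK i t ⟨ht.1, ht.2.trans_le ?_⟩⟩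
  fin_cases i <;> simp

theorem isCompact_withArcs (h : IsTripod X v γ) (hX : IsCompact X) :
    IsCompact (withArcs X γ 0) :=
  ((hX.union (h.isCompact_arc 0)).union (h.isCompact_arc 1)).union (h.isCompact_arc 2)

theorem isPathConnected_withArcs (h : IsTripod X v γ) (hXc : IsPathConnected X) :
    IsPathConnected (withArcs X γ 0) := by
  have hone : ∀ i, γ i 1 ∈ γ i '' Icc 0 1 := fun i => ⟨1, by simp, rfl⟩
  exact ((hXc.union (h.isPathConnected_arc 0) ⟨_, h.map_one_mem 0, hone 0⟩).union
    (h.isPathConnected_arc 1) ⟨_, Or.inl (h.map_one_mem 1), hone 1⟩).union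
    (h.isPathConnected_arc 2) ⟨_, Or.inl (Or.inl (h.map_one_mem 2)), hone 2⟩

theorem mem_withArcs_self (h : IsTripod X v γ) : v ∈ withArcs X γ 0 :=
  mem_withArcs.2 (Or.inr ⟨0, 0, by simp, h.map_zero 0⟩)

theorem mem_closure (h : IsTripod X v γ) (hX : IsCompact X) (hΩ : IsFaceOf X Ω) (hv : v ∈ Ω)
    (hf : f ∈ facesIn (withArcs X γ 0) Ω) : v ∈ closure f := by
  by_contra hcon
  obtain ⟨a, ha, ha1, haf⟩ := h.exists_forall_notMem isClosed_closure hcon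
  have hface := h.isFaceOf_diff hX hΩ hv ha ha1
  have hclosed := (h.isCompact_withArcs hX).isClosed
  have hmono : ∀ {i z}, z ∈ γ i '' Icc a 1 → z ∈ withArcs X γ 0 := fun {i z} hz =>
    mem_withArcs.2 (Or.inr ⟨i, image_mono (Icc_subset_Icc_left ha.le) hz⟩)
  set Ω' := ((Ω \ γ 0 '' Icc a 1) \ γ 1 '' Icc a 1) \ γ 2 '' Icc a 1
  have hfΩ' : f ⊆ Ω' := fun z hz => ⟨⟨⟨hf.2 hz, fun h' => hf.1.subset_compl hz (hmono h')⟩,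
    fun h' => hf.1.subset_compl hz (hmono h')⟩, fun h' => hf.1.subset_compl hz (hmono h')⟩
  obtain ⟨z, hz⟩ := hf.1.nonempty
  have hsub : Ω' ⊆ f := by
    refine hface.isPreconnected.subset_of_closure_inter_subset (hf.1.isOpen hclosed)
      ⟨z, hfΩ' hz, hz⟩ ?_
    rintro w ⟨hw, hwΩ'⟩
    by_contra hwf
    have hwY := hf.1.frontier_subset hclosed
      (show w ∈ frontier f from ⟨hw, fun h' => hwf (interior_subset h')⟩)
    have hwY' := hface.subset_compl hwΩ'
    rcases mem_withArcs.1 hwY with hwX | ⟨i, t, ht, rfl⟩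
    · exact hwY' (mem_withArcs.2 (Or.inl hwX))
    · rcases lt_or_ge t a with hta | hta
      · exact haf i t ⟨ht.1, hta⟩ hw
      · exact hwY' (mem_withArcs.2 (Or.inr ⟨i, t, ⟨hta, ht.2⟩, rfl⟩))
  have hvΩ' : v ∈ Ω' := ⟨⟨⟨hv, h.notMem_image_Icc 0 ha⟩, h.notMem_image_Icc 1 ha⟩,
    h.notMem_image_Icc 2 ha⟩
  exact hf.1.subset_compl (hsub hvΩ') h.mem_withArcs_self

theorem withArcs_diff_subset (h : IsTripod X v γ) (hΩ : IsFaceOf X Ω) (hv : v ∈ Ω) :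
    withArcs X γ 0 \ X ⊆ Ω := by
  rintro z ⟨hz, hzX⟩
  obtain ⟨i, t, ht, rfl⟩ := (mem_withArcs.1 hz).resolve_left hzX
  rcases ht.2.eq_or_lt with rfl | h1
  · exact absurd (h.map_one_mem i) hzX
  · exact h.subset_face hΩ hv i ⟨t, ⟨ht.1, h1⟩, rfl⟩

theorem setOf_mem_closure (h : IsTripod X v γ) (hX : IsCompact X) (hΩ : IsFaceOf X Ω)
    (hv : v ∈ Ω) :
    {f | IsFaceOf (withArcs X γ 0) f ∧ v ∈ closure f} = facesIn (withArcs X γ 0) Ω := by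
  refine subset_antisymm (fun f hf => ⟨hf.1, ?_⟩) fun f hf => ⟨hf.1, h.mem_closure hX hΩ hv hf⟩
  by_contra hcon
  have hf' := hf.1.of_not_subset hΩ (fun z hz => mem_withArcs.2 (Or.inl hz))
    (h.withArcs_diff_subset hΩ hv) hcon
  obtain ⟨z, hzΩ, hzf⟩ := _root_.mem_closure_iff.1 hf.2 Ω (hΩ.isOpen hX.isClosed) hv
  exact hcon (hf'.eq_of_mem hΩ hzf hzΩ).subset

theorem isFaceOf_of_notMem_closure (h : IsTripod X v γ) (hX : IsCompact X) (hv : v ∉ X)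
    (hf : IsFaceOf (withArcs X γ 0) f) (hvf : v ∉ closure f) : IsFaceOf X f := by
  have hΩ := isFaceOf_connectedComponentIn hv
  have hvΩ : v ∈ connectedComponentIn Xᶜ v := mem_connectedComponentIn hv
  exact hf.of_not_subset hΩ (fun z hz => mem_withArcs.2 (Or.inl hz))
    (h.withArcs_diff_subset hΩ hvΩ) fun hsub => hvf (h.mem_closure hX hΩ hvΩ ⟨hf, hsub⟩)

theorem encard_setOf_face_mem_closure (h : IsTripod X v γ) (hX : IsCompact X)
    (hXc : IsPathConnected X) (hv : v ∉ X) :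
    {f | IsFaceOf (withArcs X γ 0) f ∧ v ∈ closure f}.encard = 3 := by
  have hΩ := isFaceOf_connectedComponentIn hv
  have hvΩ : v ∈ connectedComponentIn Xᶜ v := mem_connectedComponentIn hv
  rw [h.setOf_mem_closure hX hΩ hvΩ, h.encard_facesIn hX hXc hΩ hvΩ subset_rfl,
    facesIn_self hΩ, encard_singleton]
  norm_num

end IsTripod

namespace PlaneEmbedding

variable {V : Type*} {G : SimpleGraph V} (emb : PlaneEmbedding G) {u v a b : V}

theorem isCompact_arc (h : G.Adj u v) : IsCompact (emb.arc u v) := by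
  obtain ⟨γ, hc, -, -, -, him⟩ := emb.arc_curve u v h
  exact him ▸ isCompact_Icc.image_of_continuousOn hc

theorem isPathConnected_arc (h : G.Adj u v) : IsPathConnected (emb.arc u v) := by
  obtain ⟨γ, hc, -, -, -, him⟩ := emb.arc_curve u v h
  exact him ▸ ((convex_Icc _ _).isPathConnected (nonempty_Icc.2 zero_le_one)).image' hc

theorem left_mem_arc (h : G.Adj u v) : emb.pos u ∈ emb.arc u v := by
  obtain ⟨γ, -, -, h0, -, him⟩ := emb.arc_curve u v h
  exact him ▸ ⟨0, by simp, h0⟩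

theorem right_mem_arc (h : G.Adj u v) : emb.pos v ∈ emb.arc u v :=
  emb.arc_symm v u ▸ emb.left_mem_arc h.symm

theorem arc_inter_subset (h : G.Adj v u) (h' : G.Adj a b) (ha : v ≠ a) (hb : v ≠ b) :
    emb.arc v u ∩ emb.arc a b ⊆ {emb.pos u} := by
  intro z hz
  have hne : s(v, u) ≠ s(a, b) := by
    rw [Ne, Sym2.eq_iff]
    tauto
  obtain ⟨w, rfl⟩ := emb.arc_inter v u a b h h' hne hz
  rcases emb.arc_vertex v u h w hz.1 with rfl | rfl
  · rcases emb.arc_vertex a b h' w hz.2 with rfl | rfl <;> contradiction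
  · rfl

theorem arc_inter_subset_of_ne (h : G.Adj v u) (h' : G.Adj v b) (hub : u ≠ b) :
    emb.arc v u ∩ emb.arc v b ⊆ {emb.pos v} := by
  rw [emb.arc_symm v u, emb.arc_symm v b, emb.arc_symm b v]
  exact emb.arc_inter_subset h.symm h' h.ne' hub

end PlaneEmbedding

section Partial

variable {V : Type*} {G : SimpleGraph V} (emb : PlaneEmbedding G) {x : V} (C : G.Walk x x)

/-- The drawing of the cycle `C` together with all edges incident with a vertex of `S`. -/
def partialDrawing (S : Finset V) : Set (ℝ × ℝ) :=
  {z | ∃ a b, G.Adj a b ∧ (s(a, b) ∈ C.edges ∨ a ∈ S) ∧ z ∈ emb.arc a b}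

variable {emb C}

theorem mem_drawC {z : ℝ × ℝ} :
    z ∈ drawC emb C ↔ ∃ a b, s(a, b) ∈ C.edges ∧ z ∈ emb.arc a b := by
  simp only [drawC, mem_iUnion, exists_prop]
  constructor
  · rintro ⟨e, he, hz⟩
    induction e with | h a b => exact ⟨a, b, he, hz⟩
  · rintro ⟨a, b, he, hz⟩
    exact ⟨s(a, b), he, hz⟩

theorem partialDrawing_empty : partialDrawing emb C ∅ = drawC emb C := by
  ext z
  rw [mem_drawC]
  simp only [partialDrawing, mem_ofPred_eq, Finset.notMem_empty, or_false]
  exact ⟨fun ⟨a, b, _, h⟩ => ⟨a, b, h⟩, fun ⟨a, b, h⟩ => ⟨a, b, C.adj_of_mem_edges h.1, h⟩⟩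

theorem drawC_subset_partialDrawing (S : Finset V) :
    drawC emb C ⊆ partialDrawing emb C S := fun z hz => by
  obtain ⟨a, b, h, hz⟩ := mem_drawC.1 hz
  exact ⟨a, b, C.adj_of_mem_edges h, Or.inl h, hz⟩

theorem isCompact_drawC : IsCompact (drawC emb C) := by
  have : drawC emb C = ⋃ e ∈ C.edges.toFinset, arcSet emb e := by simp [drawC]
  rw [this]
  refine C.edges.toFinset.isCompact_biUnion fun e he => ?_
  induction e with
  | h a b => exact emb.isCompact_arc (C.adj_of_mem_edges (List.mem_toFinset.1 he))

theorem isPathConnected_insert_iUnion_arcSet {u w : V} (p : G.Walk u w) :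
    IsPathConnected ({emb.pos u} ∪ ⋃ e ∈ p.edges, arcSet emb e) := by
  induction p with
  | nil => simpa using isPathConnected_singleton _
  | @cons u w' w h p ih =>
    have heq : {emb.pos u} ∪ ⋃ e ∈ (SimpleGraph.Walk.cons h p).edges, arcSet emb e =
        emb.arc u w' ∪ ({emb.pos w'} ∪ ⋃ e ∈ p.edges, arcSet emb e) := by
      have h1 := emb.left_mem_arc h
      have h2 := emb.right_mem_arc h
      have h3 : arcSet emb s(u, w') = emb.arc u w' := rfl
      simp only [SimpleGraph.Walk.edges_cons, List.mem_cons, iUnion_iUnion_eq_or_left, h3]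
      rw [← union_assoc, ← union_assoc, singleton_union, insert_eq_of_mem h1, union_singleton,
        insert_eq_of_mem h2]
    rw [heq]
    exact (emb.isPathConnected_arc h).union ih ⟨_, emb.right_mem_arc h, by simp⟩

theorem pos_mem_drawC (hC : C.IsCycle) {v : V} (hv : v ∈ C.support) :
    emb.pos v ∈ drawC emb C := by
  obtain ⟨e, he, hve⟩ :=
    (SimpleGraph.Walk.mem_support_iff_exists_mem_edges_of_not_nil hC.not_nil).1 hv
  induction e with
  | h a b =>
    refine mem_drawC.2 ⟨a, b, he, ?_⟩
    have hab := C.adj_of_mem_edges he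
    rcases Sym2.mem_iff.1 hve with rfl | rfl
    · exact emb.left_mem_arc hab
    · exact emb.right_mem_arc hab

theorem isPathConnected_drawC (hC : C.IsCycle) : IsPathConnected (drawC emb C) := by
  have h := isPathConnected_insert_iUnion_arcSet (emb := emb) C
  rwa [singleton_union, ← drawC, insert_eq_of_mem (pos_mem_drawC hC C.start_mem_support)] at h

variable [Fintype V] {S T : Finset V} {v w : V} {f : Set (ℝ × ℝ)}

theorem pos_notMem_partialDrawing (hiso : IsIsolating G C) (hS : ∀ w ∈ S, w ∉ C.support)
    (hv : v ∉ C.support) (hvS : v ∉ S) : emb.pos v ∉ partialDrawing emb C S := by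
  rintro ⟨a, b, hab, h, hz⟩
  rcases emb.arc_vertex a b hab v hz with rfl | rfl
  · exact h.elim (fun h => hv (C.fst_mem_support_of_mem_edges h)) hvS
  · exact hv (h.elim C.snd_mem_support_of_mem_edges fun h => (hiso a (hS a h)).2 _ hab)

theorem exists_isTripod (hC : C.IsCycle) (hiso : IsIsolating G C)
    (hS : ∀ w ∈ S, w ∉ C.support) (hv : v ∉ C.support) (hvS : v ∉ S) :
    ∃ γ, IsTripod (partialDrawing emb C S) (emb.pos v) γ ∧
      withArcs (partialDrawing emb C S) γ 0 = partialDrawing emb C (insert v S) := by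
  let e := (Finset.equivFinOfCardEq (hiso v hv).1).symm
  have hadj : ∀ i, G.Adj v (e i) := fun i => (Finset.mem_filter.1 (e i).2).2
  choose γ hc hi h0 h1 him using fun i => emb.arc_curve v (e i) (hadj i)
  refine ⟨γ, ⟨hc, hi, h0, fun i => ?_, fun i t ht => ?_, fun i j hij s hs t ht hst => ?_⟩, ?_⟩
  · rw [h1 i]
    exact drawC_subset_partialDrawing S (pos_mem_drawC hC ((hiso v hv).2 _ (hadj i)))
  · rintro ⟨a, b, hab, h, hz⟩
    have ht' := Ico_subset_Icc_self ht
    have ha : v ≠ a := by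
      rintro rfl
      exact h.elim (fun h => hv (C.fst_mem_support_of_mem_edges h)) hvS
    have hb : v ≠ b := by
      rintro rfl
      exact hv (h.elim C.snd_mem_support_of_mem_edges fun h => (hiso a (hS a h)).2 _ hab)
    have := emb.arc_inter_subset (hadj i) hab ha hb ⟨him i ▸ ⟨t, ht', rfl⟩, hz⟩
    exact ht.2.ne (hi i ht' (right_mem_Icc.2 zero_le_one) (this.trans (h1 i).symm))
  · have hne : (e i : V) ≠ e j := fun h => hij (e.injective (Subtype.ext h))
    have : γ i s = emb.pos v := emb.arc_inter_subset_of_ne (hadj i) (hadj j) hne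
      ⟨him i ▸ ⟨s, hs, rfl⟩, him j ▸ ⟨t, ht, hst.symm⟩⟩
    exact hi i hs (left_mem_Icc.2 zero_le_one) (this.trans (h0 i).symm)
  · ext z
    rw [IsTripod.mem_withArcs]
    constructor
    · rintro (⟨a, b, hab, h, hz⟩ | ⟨i, hz⟩)
      · exact ⟨a, b, hab, h.imp_right (Finset.mem_insert_of_mem), hz⟩
      · exact ⟨v, e i, hadj i, Or.inr (Finset.mem_insert_self _ _), him i ▸ hz⟩
    · rintro ⟨a, b, hab, h, hz⟩
      by_cases hav : a = v
      · subst hav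
        refine Or.inr ⟨e.symm ⟨b, by simpa using hab⟩, ?_⟩
        rw [him]
        simpa using hz
      · refine Or.inl ⟨a, b, hab, h.imp_right fun h => ?_, hz⟩
        exact Finset.mem_of_mem_insert_of_ne h hav

theorem isCompact_and_isPathConnected_partialDrawing (hC : C.IsCycle) (hiso : IsIsolating G C)
    (hS : ∀ w ∈ S, w ∉ C.support) :
    IsCompact (partialDrawing emb C S) ∧ IsPathConnected (partialDrawing emb C S) := by
  induction S using Finset.induction_on with
  | empty => exact partialDrawing_empty (emb := emb) (C := C) ▸
      ⟨isCompact_drawC, isPathConnected_drawC hC⟩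
  | insert v S hvS ih =>
    rw [Finset.forall_mem_insert] at hS
    obtain ⟨γ, hγ, heq⟩ := exists_isTripod (emb := emb) hC hiso hS.2 hS.1 hvS
    rw [← heq]
    exact ⟨hγ.isCompact_withArcs (ih hS.2).1, hγ.isPathConnected_withArcs (ih hS.2).2⟩

theorem le_encard_facesIn_partialDrawing (hC : C.IsCycle) (hiso : IsIsolating G C)
    (hS : ∀ w ∈ S, w ∉ C.support) {U : Set (ℝ × ℝ)} (hU : (facesIn (drawC emb C) U).Nonempty)
    (hSU : ∀ w ∈ S, connectedComponentIn (drawC emb C)ᶜ (emb.pos w) ⊆ U) :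
    2 * (S.card : ℕ∞) + 1 ≤ (facesIn (partialDrawing emb C S) U).encard := by
  induction S using Finset.induction_on with
  | empty => simpa [partialDrawing_empty, one_le_encard_iff_nonempty] using hU
  | insert v S hvS ih =>
    rw [Finset.forall_mem_insert] at hS hSU
    obtain ⟨γ, hγ, heq⟩ := exists_isTripod (emb := emb) hC hiso hS.2 hS.1 hvS
    have hv := pos_notMem_partialDrawing (emb := emb) hiso hS.2 hS.1 hvS
    obtain ⟨hX, hXc⟩ := isCompact_and_isPathConnected_partialDrawing (emb := emb) hC hiso hS.2
    rw [← heq, hγ.encard_facesIn hX hXc (isFaceOf_connectedComponentIn hv)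
      (mem_connectedComponentIn hv) ((connectedComponentIn_mono _
        (compl_subset_compl.2 (drawC_subset_partialDrawing S))).trans hSU.1),
      Finset.card_insert_of_notMem hvS]
    calc 2 * ((S.card + 1 : ℕ) : ℕ∞) + 1 = 2 * (S.card : ℕ∞) + 1 + 2 := by push_cast; ring
      _ ≤ _ := by gcongr; exact ih hS.2 hSU.2

theorem IsFaceOf.partialDrawing_of_notMem_closure (hC : C.IsCycle) (hiso : IsIsolating G C)
    (hT : ∀ w ∈ T, w ∉ C.support) (hS : ∀ w ∈ S, w ∉ C.support)
    (hfS : ∀ w ∈ S, emb.pos w ∉ closure f) (hf : IsFaceOf (partialDrawing emb C (S ∪ T)) f) :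
    IsFaceOf (partialDrawing emb C T) f := by
  induction S using Finset.induction_on with
  | empty => simpa using hf
  | insert v S hvS ih =>
    rw [Finset.forall_mem_insert] at hS hfS
    refine ih hS.2 hfS.2 ?_
    rw [Finset.insert_union] at hf
    by_cases hv : v ∈ S ∪ T
    · rwa [Finset.insert_eq_of_mem hv] at hf
    have hST : ∀ w ∈ S ∪ T, w ∉ C.support := fun w hw =>
      (Finset.mem_union.1 hw).elim (hS.2 w) (hT w)
    obtain ⟨γ, hγ, heq⟩ := exists_isTripod (emb := emb) hC hiso hST hS.1 hv
    exact hγ.isFaceOf_of_notMem_closure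
      (isCompact_and_isPathConnected_partialDrawing hC hiso hST).1
      (pos_notMem_partialDrawing hiso hST hS.1 hv) (heq ▸ hf) hfS.1

theorem encard_setOf_face_pos_mem_closure_le (hC : C.IsCycle) (hiso : IsIsolating G C)
    (hS : ∀ w ∈ S, w ∉ C.support) (hv : v ∉ C.support) :
    {f | IsFaceOf (partialDrawing emb C S) f ∧ emb.pos v ∈ closure f}.encard ≤ 3 := by
  by_cases hvS : v ∈ S
  · have hS' : ∀ w ∈ S.erase v, w ∉ C.support := fun w hw => hS w (Finset.mem_of_mem_erase hw)
    obtain ⟨γ, hγ, heq⟩ :=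
      exists_isTripod (emb := emb) hC hiso hS' hv (Finset.notMem_erase v S)
    obtain ⟨hX, hXc⟩ := isCompact_and_isPathConnected_partialDrawing (emb := emb) hC hiso hS'
    rw [Finset.insert_erase hvS] at heq
    rw [← heq]
    exact (hγ.encard_setOf_face_mem_closure hX hXc
      (pos_notMem_partialDrawing hiso hS' hv (Finset.notMem_erase v S))).le
  · have hvX := pos_notMem_partialDrawing (emb := emb) hiso hS hv hvS
    have hface := isFaceOf_connectedComponentIn hvX
    have hX := (isCompact_and_isPathConnected_partialDrawing (emb := emb) hC hiso hS).1.isClosed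
    have hsub : {f | IsFaceOf (partialDrawing emb C S) f ∧ emb.pos v ∈ closure f} ⊆
        {connectedComponentIn (partialDrawing emb C S)ᶜ (emb.pos v)} := by
      rintro f ⟨hf, hvf⟩
      obtain ⟨z, hz, hzf⟩ := mem_closure_iff.1 hvf _ (hface.isOpen hX)
        (mem_connectedComponentIn hvX)
      exact hf.eq_of_mem hface hzf hz
    refine (encard_le_encard hsub).trans ?_
    rw [encard_singleton]
    norm_num

theorem drawingOn_Hgraph_eq_partialDrawing (hC : C.IsCycle) (hiso : IsIsolating G C)
    {t : Set V} (ht : ∀ v ∈ C.support, v ∈ t) (hS : ∀ v ∈ S, v ∉ C.support)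
    (htS : ∀ v, v ∉ C.support → (v ∈ t ↔ v ∈ S)) :
    drawingOn emb (Hgraph C) t = partialDrawing emb C S := by
  have hadj : ∀ {v}, v ∈ S → ∃ b, G.Adj v b := fun {v} hv => by
    have h := (hiso v (hS v hv)).1
    obtain ⟨b, hb⟩ := Finset.card_pos.1 (h ▸ three_pos)
    exact ⟨b, (Finset.mem_filter.1 hb).2⟩
  ext z
  simp only [drawingOn, Hgraph, SimpleGraph.deleteEdges_adj, mem_union, mem_iUnion, exists_prop]
  constructor
  · rintro (⟨v, hv, rfl⟩ | ⟨a, b, ⟨hab, hch⟩, ha, hb, hz⟩)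
    · by_cases hvC : v ∈ C.support
      · exact drawC_subset_partialDrawing S (pos_mem_drawC hC hvC)
      · have hvS := (htS v hvC).1 hv
        obtain ⟨b, hb⟩ := hadj hvS
        exact ⟨v, b, hb, Or.inr hvS, emb.left_mem_arc hb⟩
    · by_cases haC : a ∈ C.support
      · by_cases hbC : b ∈ C.support
        · refine ⟨a, b, hab, Or.inl ?_, hz⟩
          by_contra hE
          exact hch ⟨hab, hE, by simp [haC, hbC]⟩
        · exact ⟨b, a, hab.symm, Or.inr ((htS b hbC).1 hb), emb.arc_symm a b ▸ hz⟩
      · exact ⟨a, b, hab, Or.inr ((htS a haC).1 ha), hz⟩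
  · rintro ⟨a, b, hab, h | h, hz⟩
    · exact Or.inr ⟨a, b, ⟨hab, fun hch => hch.2.1 h⟩, ht _ (C.fst_mem_support_of_mem_edges h),
        ht _ (C.snd_mem_support_of_mem_edges h), hz⟩
    · refine Or.inr ⟨a, b, ⟨hab, fun hch => ?_⟩, (htS a (hS a h)).2 h,
        ht _ ((hiso a (hS a h)).2 _ hab), hz⟩
      exact hS a h (hch.2.2 a (Sym2.mem_mk_left a b))

end Partial

theorem Finset.card_add_two_le_card_filter_existsUnique {α β : Type*} {W : Finset α}
    {F : Finset β} {r : α → β → Prop} (hF : ∀ f ∈ F, ∃ w ∈ W, r w f)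
    (hW : ∀ w ∈ W, {f ∈ F | r w f}.card ≤ 3) (hcard : 2 * W.card + 1 ≤ F.card) :
    W.card + 2 ≤ {f ∈ F | ∃! w, w ∈ W ∧ r w f}.card := by
  have hdc := Finset.sum_card_bipartiteAbove_eq_sum_card_bipartiteBelow r (s := W) (t := F)
  have hle : ∑ w ∈ W, (F.bipartiteAbove r w).card ≤ W.card * 3 := Finset.sum_le_card_nsmul _ _ _ hW
  have hge : ∑ f ∈ F, 2 ≤
      ∑ f ∈ F, ((W.bipartiteBelow r f).card + if ∃! w, w ∈ W ∧ r w f then 1 else 0) := by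
    refine Finset.sum_le_sum fun f hf => ?_
    obtain ⟨w, hw, hwf⟩ := hF f hf
    have hpos : 0 < (W.bipartiteBelow r f).card :=
      Finset.card_pos.2 ⟨w, (Finset.mem_bipartiteBelow r).2 ⟨hw, hwf⟩⟩
    split_ifs with h
    · lia
    · by_contra hlt
      obtain ⟨v, hv⟩ := Finset.card_eq_one.1 (show (W.bipartiteBelow r f).card = 1 by lia)
      have hmem : ∀ u, u ∈ W ∧ r u f ↔ u = v := fun u => by
        rw [← Finset.mem_bipartiteBelow r, hv, Finset.mem_singleton]
      exact h ⟨v, (hmem v).2 rfl, fun u hu => (hmem u).1 hu⟩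
  rw [Finset.sum_add_distrib, ← hdc, ← Finset.card_filter] at hge
  simp only [Finset.sum_const, smul_eq_mul] at hge
  lia

section Count

variable {V : Type*} [Fintype V] {G : SimpleGraph V} {emb : PlaneEmbedding G} {x : V}
  {C : G.Walk x x}

theorem mem_Vminus_union_Vplus {v : V} :
    v ∈ Vminus emb C ∪ Vplus emb C ↔ v ∉ C.support := by
  simp only [Finset.mem_union, Vplus, Finset.mem_filter, Finset.mem_univ, true_and]
  refine ⟨?_, fun h => ?_⟩
  · rintro (h | h)
    · exact (Finset.mem_filter.1 h).2.1
    · exact h.1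
  · by_cases hm : v ∈ Vminus emb C <;> tauto

theorem drawingOn_compl_Vplus (hC : C.IsCycle) (hiso : IsIsolating G C) :
    drawingOn emb (Hgraph C) ((↑(Vplus emb C) : Set V)ᶜ) =
      partialDrawing emb C (Vminus emb C) := by
  refine drawingOn_Hgraph_eq_partialDrawing hC hiso (fun v hv => ?_) (fun v hv => ?_)
    fun v hv => ?_
  · simp [Vplus, hv]
  · exact (Finset.mem_filter.1 hv).2.1
  · simp [Vplus, hv]

theorem drawingOn_compl_Vminus (hC : C.IsCycle) (hiso : IsIsolating G C) :
    drawingOn emb (Hgraph C) ((↑(Vminus emb C) : Set V)ᶜ) =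
      partialDrawing emb C (Vplus emb C) := by
  refine drawingOn_Hgraph_eq_partialDrawing hC hiso (fun v hv => ?_) (fun v hv => ?_)
    fun v hv => ?_
  · simp [Vminus, hv]
  · exact (Finset.mem_filter.1 hv).2.1
  · simp [Vplus, hv]

theorem finite_setOf_minorFaceOf (hC : C.IsCycle) (hiso : IsIsolating G C) {S : Finset V}
    (hS : ∀ w ∈ S, w ∉ C.support) :
    {f | MinorFaceOf emb C (partialDrawing emb C S) f}.Finite := by
  refine ((Vminus emb C ∪ Vplus emb C).finite_toSet.biUnion fun w hw =>
    finite_of_encard_le_coe (k := 3) (encard_setOf_face_pos_mem_closure_le (emb := emb) hC hiso hS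
      (mem_Vminus_union_Vplus.1 hw))).subset ?_
  rintro f ⟨hf, w, ⟨hw, hwf⟩, -⟩
  exact mem_biUnion hw ⟨hf, hwf⟩

theorem card_add_two_le_ncard_minorFaces (hC : C.IsCycle) (hiso : IsIsolating G C)
    (hne : (Vminus emb C ∪ Vplus emb C).Nonempty) :
    (Vminus emb C ∪ Vplus emb C).card + 2 ≤ (Mminus emb C ∪ Mplus emb C).ncard := by
  set W := Vminus emb C ∪ Vplus emb C
  have hW : ∀ {w}, w ∈ W ↔ w ∉ C.support := mem_Vminus_union_Vplus
  have hWs : ∀ w ∈ W, w ∉ C.support := fun w => hW.1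
  have hms : ∀ w ∈ Vminus emb C, w ∉ C.support := fun w hw => hWs w (Finset.mem_union_left _ hw)
  have hps : ∀ w ∈ Vplus emb C, w ∉ C.support := fun w hw => hWs w (Finset.mem_union_right _ hw)
  have hposC : ∀ w ∈ W, emb.pos w ∉ drawC emb C := fun w hw =>
    partialDrawing_empty (emb := emb) (C := C) ▸
      pos_notMem_partialDrawing hiso (by simp) (hWs w hw) (Finset.notMem_empty w)
  set U : Set (ℝ × ℝ) := ⋃ w ∈ W, connectedComponentIn (drawC emb C)ᶜ (emb.pos w)
  have hU : ∀ w ∈ W, connectedComponentIn (drawC emb C)ᶜ (emb.pos w) ⊆ U := fun w hw =>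
    subset_biUnion_of_mem (u := fun w => connectedComponentIn (drawC emb C)ᶜ (emb.pos w)) hw
  have hcard := le_encard_facesIn_partialDrawing (emb := emb) hC hiso hWs
    (hne.elim fun w hw => ⟨_, isFaceOf_connectedComponentIn (hposC w hw), hU w hw⟩) hU
  have hinc : ∀ f ∈ facesIn (partialDrawing emb C W) U, ∃ w ∈ W, emb.pos w ∈ closure f := by
    rintro f ⟨hf, hfU⟩
    by_contra! hcon
    have hfC := IsFaceOf.partialDrawing_of_notMem_closure (T := ∅) hC hiso (by simp) hWs hcon
      (by simpa using hf)
    rw [partialDrawing_empty] at hfC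
    obtain ⟨z, hz⟩ := hf.nonempty
    obtain ⟨w, hw, hzw⟩ := mem_iUnion₂.1 (hfU hz)
    have heq := hfC.eq_of_mem (isFaceOf_connectedComponentIn (hposC w hw)) hz hzw
    exact hcon w hw (subset_closure (heq ▸ mem_connectedComponentIn (hposC w hw)))
  have hle := fun w (hw : w ∈ W) =>
    encard_setOf_face_pos_mem_closure_le (emb := emb) hC hiso hWs (hWs w hw)
  have hfin : (facesIn (partialDrawing emb C W) U).Finite := by
    refine (W.finite_toSet.biUnion fun w hw =>
      finite_of_encard_le_coe (k := 3) (hle w hw)).subset fun f hf => ?_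
    obtain ⟨w, hw, hwf⟩ := hinc f hf
    exact mem_biUnion hw ⟨hf.1, hwf⟩
  obtain ⟨F, hF⟩ := hfin.exists_finset_coe
  have hFmem : ∀ {f}, f ∈ F ↔ f ∈ facesIn (partialDrawing emb C W) U := fun {f} => by simp [← hF]
  rw [← hF, encard_coe_eq_coe_finsetCard] at hcard
  refine (Finset.card_add_two_le_card_filter_existsUnique (W := W) (F := F)
    (r := fun w f => emb.pos w ∈ closure f) (fun f hf => hinc f (hFmem.1 hf)) (fun w hw => ?_)
    (by exact_mod_cast hcard)).trans ?_
  · have hsub : (↑{f ∈ F | emb.pos w ∈ closure f} : Set (Set (ℝ × ℝ))) ⊆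
        {f | IsFaceOf (partialDrawing emb C W) f ∧ emb.pos w ∈ closure f} := fun f hf => by
      obtain ⟨h1, h2⟩ := Finset.mem_filter.1 hf
      exact ⟨(hFmem.1 h1).1, h2⟩
    have := (encard_le_encard hsub).trans (hle w hw)
    rw [encard_coe_eq_coe_finsetCard] at this
    exact_mod_cast this
  · rw [← ncard_coe_finset]
    refine ncard_le_ncard (fun f hf => ?_) ?_
    · obtain ⟨hfF, w, ⟨hw, hwf⟩, huniq⟩ := Finset.mem_filter.1 hf
      have hface := (hFmem.1 hfF).1
      have hdisj : Disjoint (Vminus emb C) (Vplus emb C) :=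
        Finset.disjoint_left.2 fun v hv hv' => (Finset.mem_filter.1 hv').2.2 hv
      have hex : ∃! v, v ∈ Vminus emb C ∪ Vplus emb C ∧ incVertex emb f v := ⟨w, ⟨hw, hwf⟩, huniq⟩
      rcases Finset.mem_union.1 hw with hwm | hwp
      · refine Or.inl ⟨?_, hex⟩
        rw [drawingOn_compl_Vplus hC hiso]
        refine IsFaceOf.partialDrawing_of_notMem_closure hC hiso hms hps (fun v hv hvf => ?_)
          (Finset.union_comm (Vminus emb C) (Vplus emb C) ▸ hface)
        exact Finset.disjoint_left.1 hdisj hwm (huniq v ⟨Finset.mem_union_right _ hv, hvf⟩ ▸ hv)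
      · refine Or.inr ⟨?_, hex⟩
        rw [drawingOn_compl_Vminus hC hiso]
        refine IsFaceOf.partialDrawing_of_notMem_closure hC hiso hps hms (fun v hv hvf => ?_)
          hface
        exact Finset.disjoint_left.1 hdisj (huniq v ⟨Finset.mem_union_left _ hv, hvf⟩ ▸ hv) hwp
    · rw [Mminus, Mplus, drawingOn_compl_Vplus hC hiso, drawingOn_compl_Vminus hC hiso]
      exact (finite_setOf_minorFaceOf hC hiso hms).union (finite_setOf_minorFaceOf hC hiso hps)

end Count

end

/-- For an essentially 4-connected plane graph `G` with an isolating cycle `C` and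
`|V⁻| ≥ 1`, `|V⁺| ≥ 1`, one has `|M⁻ ∪ M⁺| ≥ |V⁻ ∪ V⁺| + 2`. -/
theorem stmt2_minor_face_count
    {V : Type*} [Fintype V] {G : SimpleGraph V}
    (h4 : EssentiallyFourConnected G) (emb : PlaneEmbedding G)
    {x : V} (C : G.Walk x x) (hC : C.IsCycle) (hiso : IsIsolating G C)
    (hVm : (Vminus emb C).Nonempty) (hVp : (Vplus emb C).Nonempty) :
    (Vminus emb C ∪ Vplus emb C).card + 2 ≤ (Mminus emb C ∪ Mplus emb C).ncard := by
  exact card_add_two_le_ncard_minorFaces hC hiso (hVm.mono Finset.subset_union_left)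

end
end

section
/- Let G be an essentially 4-connected plane graph, let C be a longest isolating cycle of G, and let H be the plane graph obtained from G by deleting all chords of C. Then every minor face of H is a j-face with j ≥ 2; that is, every minor face of H is incident with at least two edges of C. -/
open scoped Classical

noncomputable section

/-- The difference `z - p` of two points of the plane, as a complex number. -/
def planeDiff (p z : ℝ × ℝ) : ℂ := ((z.1 - p.1 : ℝ) : ℂ) + ((z.2 - p.2 : ℝ) : ℂ) * Complex.I

lemma continuous_planeDiff (p : ℝ × ℝ) : Continuous (planeDiff p) := by
  unfold planeDiff; fun_prop

lemma planeDiff_ne_zero {p z : ℝ × ℝ} (h : z ≠ p) : planeDiff p z ≠ 0 := by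
  intro h0
  apply h
  have h1 := congrArg Complex.re h0
  have h2 := congrArg Complex.im h0
  simp [planeDiff] at h1 h2
  exact Prod.ext (by linarith) (by linarith)

lemma exists_continuous_log {X : Type*} [TopologicalSpace X] [SimplyConnectedSpace X]
    [LocallyPathConnectedSpace X] {f : X → ℂ} (hf : Continuous f) (h0 : ∀ x, f x ≠ 0)
    (a : X) {l : ℂ} (hl : Complex.exp l = f a) :
    ∃ L : X → ℂ, Continuous L ∧ (∀ x, Complex.exp (L x) = f x) ∧ L a = l := by
  obtain ⟨F, ⟨h1, h2⟩, -⟩ := Complex.isCoveringMap_exp.existsUnique_continuousMap_lifts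
    (⟨fun x => ⟨f x, h0 x⟩, by fun_prop⟩ : C(X, {z : ℂ // z ≠ 0})) a l (Subtype.ext hl)
  exact ⟨F, F.continuous, fun x => congrArg Subtype.val (congrFun h2 x), h1⟩

lemma exists_continuousOn_log_Icc {h : ℝ → ℂ} {a b : ℝ}
    (hc : ContinuousOn h (Set.Icc a b)) (h0 : ∀ t ∈ Set.Icc a b, h t ≠ 0) (c : ℝ) {l : ℂ}
    (hl : c ∈ Set.Icc a b → Complex.exp l = h c) :
    ∃ L : ℝ → ℂ, ContinuousOn L (Set.Icc a b) ∧
      (∀ t ∈ Set.Icc a b, Complex.exp (L t) = h t) ∧ (c ∈ Set.Icc a b → L c = l) := by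
  by_cases hab : a ≤ b
  · have key : ∀ c' ∈ Set.Icc a b, ∀ l' : ℂ, Complex.exp l' = h c' →
        ∃ L : ℝ → ℂ, ContinuousOn L (Set.Icc a b) ∧
        (∀ t ∈ Set.Icc a b, Complex.exp (L t) = h t) ∧ L c' = l' := by
      intro c' hc' l' hl'
      obtain ⟨L, h1, h2, h3⟩ := exists_continuous_log
        (f := Set.IccExtend hab ((Set.Icc a b).domRestrict h))
        (hc.domRestrict.Icc_extend') (fun x => h0 _ (Set.projIcc a b hab x).2) c'
        (l := l') (by rw [Set.IccExtend_of_mem _ _ hc', hl']; rfl)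
      exact ⟨L, h1.continuousOn, fun t ht => by
        rw [h2, Set.IccExtend_of_mem _ _ ht]; rfl, h3⟩
    by_cases hcm : c ∈ Set.Icc a b
    · obtain ⟨L, h1, h2, h3⟩ := key c hcm l (hl hcm)
      exact ⟨L, h1, h2, fun _ => h3⟩
    · obtain ⟨L, h1, h2, h3⟩ := key a ⟨le_rfl, hab⟩ _
        (Complex.exp_log (h0 a ⟨le_rfl, hab⟩))
      exact ⟨L, h1, h2, fun h => absurd h hcm⟩
  · exact ⟨0, by simp [Set.Icc_eq_empty hab], by simp [Set.Icc_eq_empty hab],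
      by simp [Set.Icc_eq_empty hab]⟩

/-- A bounded set cannot have a boundary on which `z - p` has a continuous logarithm,
for `p` in the set. -/
lemma no_log_on_frontier {U : Set (ℝ × ℝ)} (hb : Bornology.IsBounded U)
    {p : ℝ × ℝ} (hp : p ∈ U) (g : ℝ × ℝ → ℂ) (hg : ContinuousOn g (frontier U))
    (he : ∀ z ∈ frontier U, Complex.exp (g z) = planeDiff p z) : False := by
  obtain ⟨G, hG⟩ := ContinuousMap.exists_restrict_eq isClosed_frontier
    (⟨(frontier U).domRestrict g, hg.domRestrict⟩ : C(frontier U, ℂ))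
  have hG' : ∀ z ∈ frontier U, G z = g z := fun z hz => congrArg (fun k => k ⟨z, hz⟩) hG
  have hcont : Continuous (fun z => if z ∈ U then Complex.exp (G z) else planeDiff p z) := by
    refine Continuous.if (fun z hz => ?_) (by fun_prop) (continuous_planeDiff p)
    have hz' : z ∈ frontier U := hz
    rw [hG' z hz', he z hz']
  have hne : ∀ z, (if z ∈ U then Complex.exp (G z) else planeDiff p z) ≠ 0 := by
    intro z
    split_ifs with h
    · exact Complex.exp_ne_zero _
    · exact planeDiff_ne_zero (fun h' => h (h' ▸ hp))
  obtain ⟨L, hL, hLe, -⟩ := exists_continuous_log hcont hne p (Complex.exp_log (hne p))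
  obtain ⟨R, hR, hUR⟩ := hb.subset_ball_lt 0 p
  set c : ℝ → ℝ × ℝ := fun t => (p.1 + 2 * R * Real.cos t, p.2 + 2 * R * Real.sin t) with hc
  have hcU : ∀ t, c t ∉ U := by
    intro t ht
    have h1 := hUR ht
    rw [Metric.mem_ball, Prod.dist_eq, max_lt_iff, Real.dist_eq, Real.dist_eq, abs_lt, abs_lt] at h1
    simp only [hc] at h1
    nlinarith [Real.sin_sq_add_cos_sq t, mul_pos hR hR, h1.1.1, h1.1.2, h1.2.1, h1.2.2,
      sq_nonneg (R * Real.cos t), sq_nonneg (R * Real.sin t)]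
  have hcd : ∀ t : ℝ, Complex.exp (L (c t)) = Complex.exp (Complex.log (2 * R) + t * Complex.I) := by
    intro t
    rw [hLe, if_neg (hcU t), Complex.exp_add, Complex.exp_log, Complex.exp_mul_I]
    · simp [planeDiff, hc]; ring
    · norm_cast; positivity
  have hcc : Continuous c := by fun_prop
  have h := Complex.isCoveringMap_exp.eq_of_comp_eq
    (g₁ := fun t : ℝ => L (c t) - t * Complex.I) (g₂ := fun _ => L (c 0))
    (by fun_prop) (by fun_prop)
    (by
      funext t
      refine Subtype.ext ?_
      change Complex.exp (L (c t) - t * Complex.I) = Complex.exp (L (c 0))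
      rw [Complex.exp_sub, hcd, hcd, ← Complex.exp_sub]
      simp) 0 (by simp)
  have h2 := congrFun h (2 * Real.pi)
  have h3 : c (2 * Real.pi) = c 0 := by simp [hc]
  simp [h3, Real.pi_ne_zero] at h2

lemma isPreconnected_norm_gt {R : ℝ} (hR : 0 ≤ R) :
    IsPreconnected {z : ℝ × ℝ | R < ‖z‖} := by
  have h : {z : ℝ × ℝ | R < ‖z‖} =
      (fun q : ℝ × (ℝ × ℝ) => q.1 • q.2) '' (Set.Ioi R ×ˢ Metric.sphere 0 1) := by
    ext z
    constructor
    · intro hz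
      have hz' : R < ‖z‖ := hz
      have hz0 : ‖z‖ ≠ 0 := by linarith
      exact ⟨(‖z‖, ‖z‖⁻¹ • z), ⟨hz', by simp [norm_smul, hz0]⟩, by simp [smul_smul, hz0]⟩
    · rintro ⟨⟨r, s⟩, ⟨h1, h2⟩, rfl⟩
      simp only [Set.mem_Ioi, mem_sphere_zero_iff_norm] at h1 h2
      simp only [Set.mem_ofPred_eq, norm_smul, h2, mul_one, Real.norm_eq_abs]
      exact h1.trans_le (le_abs_self r)
  rw [h]
  exact (isPreconnected_Ioi.prod (isPreconnected_sphere
    (by rw [rank_prod']; simp; norm_num) 0 1)).image _ (by fun_prop)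

/-- If `F` is a closed set containing the boundary of a face of a compact set `D`, and `z - p`
has a continuous logarithm on `F` for every `p` off `F`, then the face is dense in the plane. -/
lemma compl_closure_face_eq_empty {D F f : Set (ℝ × ℝ)} (hD : IsCompact D)
    (hF : frontier f ⊆ F) {z : ℝ × ℝ} (hz : z ∉ D) (hf : f = connectedComponentIn Dᶜ z)
    (hlog : ∀ p ∉ F, ∃ g : ℝ × ℝ → ℂ, ContinuousOn g F ∧
      ∀ y ∈ F, Complex.exp (g y) = planeDiff p y)
    (hFf : ∀ y ∈ F, y ∈ closure f ∧ y ∉ f) : (closure f)ᶜ = ∅ := by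
  have hop : IsOpen f := hf ▸ hD.isClosed.isOpen_compl.connectedComponentIn
  have hzf : z ∈ f := hf ▸ mem_connectedComponentIn hz
  by_contra hne
  obtain ⟨q, hq⟩ := Set.nonempty_iff_ne_empty.2 hne
  by_cases hb : Bornology.IsBounded f
  · obtain ⟨g, hg1, hg2⟩ := hlog z (fun h => (hFf z h).2 hzf)
    exact no_log_on_frontier hb hzf g (hg1.mono hF) (fun y hy => hg2 y (hF hy))
  · obtain ⟨g, hg1, hg2⟩ := hlog q (fun h => hq (hFf q h).1)
    have hfr : frontier (closure f)ᶜ ⊆ F := by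
      rw [frontier_compl]
      exact frontier_closure_subset.trans hF
    refine no_log_on_frontier ?_ hq g (hg1.mono hfr)
      (fun y hy => hg2 y (hfr hy))
    obtain ⟨R, hR, hDR⟩ := hD.isBounded.subset_closedBall_lt 0 0
    have hsub : {y : ℝ × ℝ | R < ‖y‖} ⊆ Dᶜ := by
      intro y hy hyD
      have := hDR hyD
      rw [mem_closedBall_zero_iff] at this
      exact absurd hy (not_lt.2 this)
    have : ∃ y ∈ f, R < ‖y‖ := by
      by_contra hcon
      push Not at hcon
      exact hb (Metric.isBounded_closedBall.subset
        (fun y hy => mem_closedBall_zero_iff.2 (hcon y hy)))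
    obtain ⟨y, hy, hyR⟩ := this
    have h2 : {y : ℝ × ℝ | R < ‖y‖} ⊆ f := by
      rw [hf] at hy ⊢
      rw [connectedComponentIn_eq hy]
      exact (isPreconnected_norm_gt hR.le).subset_connectedComponentIn hyR hsub
    refine (Metric.isBounded_closedBall (x := (0 : ℝ × ℝ)) (r := R)).subset (fun w hw => ?_)
    rw [mem_closedBall_zero_iff]
    by_contra hlt
    exact hw (subset_closure (h2 (not_le.1 hlt)))

lemma frontier_face_subset {D f : Set (ℝ × ℝ)} (hD : IsClosed D) {z : ℝ × ℝ}
    (hf : f = connectedComponentIn Dᶜ z) : frontier f ⊆ D := by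
  intro y hy
  by_contra hyD
  have hop : IsOpen f := hf ▸ hD.isOpen_compl.connectedComponentIn
  rw [hop.frontier_eq] at hy
  obtain ⟨w, hw1, hw2⟩ := mem_closure_iff.1 hy.1 _
    (hD.isOpen_compl.connectedComponentIn (x := y)) (mem_connectedComponentIn hyD)
  apply hy.2
  rw [hf] at hw2 ⊢
  rw [connectedComponentIn_eq hw2, ← connectedComponentIn_eq hw1]
  exact mem_connectedComponentIn hyD

/-- `A` is a simple arc from `a` to `b`. -/
def IsArc (A : Set (ℝ × ℝ)) (a b : ℝ × ℝ) : Prop :=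
  ∃ γ : ℝ → ℝ × ℝ, ContinuousOn γ (Set.Icc 0 1) ∧ Set.InjOn γ (Set.Icc 0 1) ∧
      γ 0 = a ∧ γ 1 = b ∧ γ '' Set.Icc 0 1 = A

lemma IsArc.isCompact {A : Set (ℝ × ℝ)} {a b : ℝ × ℝ} (h : IsArc A a b) : IsCompact A := by
  obtain ⟨γ, h1, -, -, -, rfl⟩ := h
  exact isCompact_Icc.image_of_continuousOn h1

/-- A continuous parameter on an arc. -/
lemma exists_continuousOn_param {γ : ℝ → ℝ × ℝ} (h1 : ContinuousOn γ (Set.Icc 0 1))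
    (h2 : Set.InjOn γ (Set.Icc 0 1)) :
    ContinuousOn (Function.invFunOn γ (Set.Icc 0 1)) (γ '' Set.Icc 0 1) := by
  rw [continuousOn_iff_isClosed]
  intro t ht
  refine ⟨γ '' (t ∩ Set.Icc 0 1), ((isCompact_Icc.inter_left ht).image_of_continuousOn
    (h1.mono Set.inter_subset_right)).isClosed, ?_⟩
  ext y
  constructor
  · rintro ⟨hy, s, hs, rfl⟩
    refine ⟨⟨s, ⟨?_, hs⟩, rfl⟩, s, hs, rfl⟩
    have := h2.leftInvOn_invFunOn hs
    rw [Set.mem_preimage, this] at hy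
    exact hy
  · rintro ⟨⟨s, ⟨hst, hs⟩, rfl⟩, -⟩
    refine ⟨?_, s, hs, rfl⟩
    rw [Set.mem_preimage, h2.leftInvOn_invFunOn hs]
    exact hst

lemma IsArc.exists_log_of_subset {A F : Set (ℝ × ℝ)} {a b p : ℝ × ℝ} (h : IsArc A a b)
    (hAF : A ⊆ F) (hp : p ∉ F) {l : ℂ} (hl : Complex.exp l = planeDiff p a) :
    ∃ g : ℝ × ℝ → ℂ, ContinuousOn g A ∧ (∀ y ∈ A, Complex.exp (g y) = planeDiff p y) ∧
      g a = l := by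
  obtain ⟨γ, h1, h2, rfl, rfl, rfl⟩ := h
  obtain ⟨L, hL1, hL2, hL3⟩ := exists_continuousOn_log_Icc (a := 0) (b := 1)
    (h := fun t => planeDiff p (γ t)) ((continuous_planeDiff p).comp_continuousOn h1)
    (fun t ht => planeDiff_ne_zero (fun he => hp (hAF (he ▸ Set.mem_image_of_mem γ ht)))) 0
    (fun _ => hl)
  have hinv := h2.leftInvOn_invFunOn
  refine ⟨fun y => L (Function.invFunOn γ (Set.Icc 0 1) y),
    hL1.comp (exists_continuousOn_param h1 h2) ?_, ?_, ?_⟩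
  · rintro y ⟨s, hs, rfl⟩
    rw [hinv hs]; exact hs
  · rintro y ⟨s, hs, rfl⟩
    simp only [hinv hs]; exact hL2 s hs
  · have h0 : (0 : ℝ) ∈ Set.Icc (0 : ℝ) 1 := by simp
    simp only [hinv h0]
    exact hL3 h0

lemma IsArc.exists_log_of_not_subset {A F : Set (ℝ × ℝ)} {a b p : ℝ × ℝ} (h : IsArc A a b)
    (hF : IsClosed F) (hAF : ¬ A ⊆ F) (hp : p ∉ F) {l m : ℂ}
    (hl : a ∈ F → Complex.exp l = planeDiff p a) (hm : b ∈ F → Complex.exp m = planeDiff p b) :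
    ∃ g : ℝ × ℝ → ℂ, ContinuousOn g (A ∩ F) ∧
      (∀ y ∈ A ∩ F, Complex.exp (g y) = planeDiff p y) ∧
      (a ∈ F → g a = l) ∧ (b ∈ F → g b = m) := by
  obtain ⟨γ, h1, h2, rfl, rfl, rfl⟩ := h
  obtain ⟨t₀, ht₀, htF, htp⟩ : ∃ t₀ ∈ Set.Icc (0 : ℝ) 1, γ t₀ ∉ F ∧
      ∀ t ∈ Set.Icc (0 : ℝ) 1, γ t = p → t = t₀ := by
    by_cases hpA : p ∈ γ '' Set.Icc 0 1
    · obtain ⟨s, hs, rfl⟩ := hpA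
      exact ⟨s, hs, hp, fun t ht he => h2 ht hs he⟩
    · obtain ⟨y, ⟨s, hs, rfl⟩, hy⟩ := Set.not_subset.1 hAF
      exact ⟨s, hs, hy, fun t ht he => absurd ⟨t, ht, he⟩ hpA⟩
  have hS : IsClosed (Set.Icc (0 : ℝ) 1 ∩ γ ⁻¹' F) :=
    h1.preimage_isClosed_of_isClosed isClosed_Icc hF
  obtain ⟨ε, hε, hball⟩ := Metric.isOpen_iff.1 hS.isOpen_compl t₀ (fun h => htF h.2)
  have hfar : ∀ t ∈ Set.Icc (0 : ℝ) 1, γ t ∈ F → t ≤ t₀ - ε ∨ t₀ + ε ≤ t := by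
    intro t ht htF
    by_contra hcon
    push Not at hcon
    refine hball (Metric.mem_ball.2 ?_) ⟨ht, htF⟩
    rw [Real.dist_eq, abs_lt]
    constructor <;> linarith
  have hc := (continuous_planeDiff p).comp_continuousOn h1
  obtain ⟨L, hL1, hL2, hL3⟩ := exists_continuousOn_log_Icc (a := 0) (b := t₀ - ε)
    (h := fun t => planeDiff p (γ t)) (hc.mono (Set.Icc_subset_Icc_right (by linarith [ht₀.2])))
    (fun t ht => planeDiff_ne_zero (fun he => by
      have := htp t ⟨ht.1, by linarith [ht.2, ht₀.2]⟩ he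
      linarith [ht.2])) 0 (l := if γ 0 ∈ F then l else Complex.log (planeDiff p (γ 0)))
    (fun h => by
      split_ifs with h'
      · exact hl h'
      · refine Complex.exp_log (planeDiff_ne_zero (fun he => ?_))
        have := htp 0 (by simp) he
        linarith [h.2])
  obtain ⟨M, hM1, hM2, hM3⟩ := exists_continuousOn_log_Icc (a := t₀ + ε) (b := 1)
    (h := fun t => planeDiff p (γ t)) (hc.mono (Set.Icc_subset_Icc_left (by linarith [ht₀.1])))
    (fun t ht => planeDiff_ne_zero (fun he => by
      have := htp t ⟨by linarith [ht.1, ht₀.1], ht.2⟩ he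
      linarith [ht.1])) 1 (l := if γ 1 ∈ F then m else Complex.log (planeDiff p (γ 1)))
    (fun h => by
      split_ifs with h'
      · exact hm h'
      · refine Complex.exp_log (planeDiff_ne_zero (fun he => ?_))
        have := htp 1 (by simp) he
        linarith [h.1])
  have hinv := h2.leftInvOn_invFunOn
  set K : ℝ → ℂ := fun t => if t ≤ t₀ then L t else M t with hK
  have hKL : Set.EqOn K L (Set.Icc 0 (t₀ - ε)) := fun t ht => if_pos (by linarith [ht.2])
  have hKM : Set.EqOn K M (Set.Icc (t₀ + ε) 1) := fun t ht => if_neg (by linarith [ht.1])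
  have hKc : ContinuousOn K (Set.Icc 0 (t₀ - ε) ∪ Set.Icc (t₀ + ε) 1) :=
    (hL1.congr hKL).union_of_isClosed (hM1.congr hKM) isClosed_Icc isClosed_Icc
  have h0 : (0 : ℝ) ∈ Set.Icc (0 : ℝ) 1 := by simp
  have h01 : (1 : ℝ) ∈ Set.Icc (0 : ℝ) 1 := by simp
  have hmem : ∀ t ∈ Set.Icc (0 : ℝ) 1, γ t ∈ F →
      t ∈ Set.Icc 0 (t₀ - ε) ∪ Set.Icc (t₀ + ε) 1 := fun t ht htF =>
    (hfar t ht htF).imp (fun h => ⟨ht.1, h⟩) (fun h => ⟨h, ht.2⟩)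
  refine ⟨fun y => K (Function.invFunOn γ (Set.Icc 0 1) y),
    hKc.comp ((exists_continuousOn_param h1 h2).mono Set.inter_subset_left) ?_, ?_, ?_, ?_⟩
  · rintro y ⟨⟨s, hs, rfl⟩, hsF⟩
    rw [hinv hs]
    exact hmem s hs hsF
  · rintro y ⟨⟨s, hs, rfl⟩, hsF⟩
    simp only [hinv hs]
    rcases hmem s hs hsF with h | h
    · rw [hKL h]; exact hL2 s h
    · rw [hKM h]; exact hM2 s h
  · intro hF0
    simp only [hinv h0]
    have h : (0 : ℝ) ∈ Set.Icc 0 (t₀ - ε) := (hmem 0 h0 hF0).resolve_right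
      (fun h => by linarith [h.1, ht₀.1])
    rw [hKL h, hL3 h, if_pos hF0]
  · intro hF1
    simp only [hinv h01]
    have h : (1 : ℝ) ∈ Set.Icc (t₀ + ε) 1 := (hmem 1 h01 hF1).resolve_left
      (fun h => by linarith [h.2, ht₀.2])
    rw [hKM h, hM3 h, if_pos hF1]

/-- Logarithms on finitely many closed pieces that agree on the overlaps can be glued. -/
lemma exists_log_of_finite_cover {ι : Type*} [Finite ι] {A : ι → Set (ℝ × ℝ)}
    (hA : ∀ i, IsClosed (A i)) (h : ℝ × ℝ → ℂ) (g : ι → ℝ × ℝ → ℂ)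
    (hc : ∀ i, ContinuousOn (g i) (A i)) (he : ∀ i, ∀ y ∈ A i, Complex.exp (g i y) = h y)
    (hag : ∀ i j, ∀ y ∈ A i ∩ A j, g i y = g j y) :
    ∃ G : ℝ × ℝ → ℂ, ContinuousOn G (⋃ i, A i) ∧ ∀ y ∈ ⋃ i, A i, Complex.exp (G y) = h y := by
  have hG : ∀ i, ∀ y ∈ A i,
      (if hy : ∃ j, y ∈ A j then g hy.choose y else 0) = g i y := by
    intro i y hy
    have hex : ∃ j, y ∈ A j := ⟨i, hy⟩
    rw [dif_pos hex]
    exact hag _ _ y ⟨hex.choose_spec, hy⟩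
  refine ⟨fun y => if hy : ∃ j, y ∈ A j then g hy.choose y else 0, ?_, ?_⟩
  · exact (locallyFinite_of_finite A).continuousOn_iUnion hA
      (fun i => (hc i).congr (hG i))
  · intro y hy
    obtain ⟨i, hi⟩ := Set.mem_iUnion.1 hy
    simp only [hG i y hi]
    exact he i y hi

section MinorFaces

variable {V : Type*} {G : SimpleGraph V}

lemma exists_isCycle_insert_of_snd {u v : V} {c : G.Walk u u} (hc : c.IsCycle)
    (hv : v ∉ c.support) (hu : G.Adj u v) (hs : G.Adj v c.snd) :
    ∃ c' : G.Walk u u, c'.IsCycle ∧ c'.length = c.length + 1 ∧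
      v ∈ c'.support ∧ ∀ w ∈ c.support, w ∈ c'.support := by
  cases c with
  | nil => exact absurd hc SimpleGraph.Walk.not_isCycle_nil
  | @cons _ w _ h q =>
    rw [SimpleGraph.Walk.snd_cons] at hs
    rw [SimpleGraph.Walk.support_cons, List.mem_cons, not_or] at hv
    rw [SimpleGraph.Walk.cons_isCycle_iff] at hc
    refine ⟨.cons hu (.cons hs q), ?_, by simp, by simp, ?_⟩
    · rw [SimpleGraph.Walk.cons_isCycle_iff]
      refine ⟨hc.1.cons hv.2, ?_⟩
      rw [SimpleGraph.Walk.edges_cons, List.mem_cons, not_or]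
      refine ⟨fun he => ?_, fun he => hv.2 (q.snd_mem_support_of_mem_edges he)⟩
      have := h.ne
      have := hu.ne
      aesop
    · intro z hz
      simp only [SimpleGraph.Walk.support_cons, List.mem_cons] at hz ⊢
      tauto

/-- A cycle can be extended through a common neighbour of the ends of one of its edges. -/
lemma exists_isCycle_insert {x u w v : V} {c : G.Walk x x} (hc : c.IsCycle)
    (he : s(u, w) ∈ c.edges) (hv : v ∉ c.support) (hu : G.Adj v u) (hw : G.Adj v w) :
    ∃ c' : G.Walk u u, c'.IsCycle ∧ c'.length = c.length + 1 ∧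
      v ∈ c'.support ∧ ∀ y ∈ c.support, y ∈ c'.support := by
  have hus : u ∈ c.support := c.fst_mem_support_of_mem_edges he
  have hr : (c.rotate u hus).IsCycle := hc.rotate hus
  have hlen : (c.rotate u hus).length = c.length := by simp
  have hsup : ∀ y, y ∈ (c.rotate u hus).support ↔ y ∈ c.support := by simp
  have her : s(u, w) ∈ (c.rotate u hus).edges := (c.rotate_edges u hus).mem_iff.2 he
  rw [← hlen]
  simp only [← hsup] at hv ⊢
  generalize c.rotate u hus = r at hr her hv
  have hsnd : r.snd = w ∨ r.reverse.snd = w := by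
    cases r with
    | nil => exact absurd hr SimpleGraph.Walk.not_isCycle_nil
    | @cons _ z _ h q =>
      rw [SimpleGraph.Walk.edges_cons, List.mem_cons] at her
      have hq := SimpleGraph.Walk.cons_isCycle_iff q h |>.1 hr
      rcases her with h1 | h1
      · left
        rw [SimpleGraph.Walk.snd_cons]
        exact (Sym2.congr_right.1 h1).symm
      · right
        rw [SimpleGraph.Walk.snd_reverse, SimpleGraph.Walk.penultimate_cons_of_not_nil]
        · exact (hq.1.eq_penultimate_of_mem_edges h1).symm
        · intro hn
          cases hn
          simp at h1
  rcases hsnd with h | h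
  · exact exists_isCycle_insert_of_snd hr hv hu.symm (h ▸ hw)
  · simpa using exists_isCycle_insert_of_snd hr.reverse (by simpa using hv) hu.symm (h ▸ hw)

lemma IsLongestIsolatingCycle.not_adj_of_mem_edges [Fintype V] {x u w v : V} {C : G.Walk x x}
    (hC : IsLongestIsolatingCycle G C) (he : s(u, w) ∈ C.edges) (hv : v ∉ C.support)
    (hu : G.Adj v u) : ¬ G.Adj v w := by
  intro hw
  obtain ⟨c', h1, h2, -, h4⟩ := exists_isCycle_insert hC.1 he hv hu hw
  have := hC.2.2 u c' h1 fun y hy =>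
    have hy' : y ∉ C.support := fun h => hy (h4 y h)
    ⟨(hC.2.1 y hy').1, fun z hz => h4 z ((hC.2.1 y hy').2 z hz)⟩
  omega

lemma PlaneEmbedding.isArc (emb : PlaneEmbedding G) {u w : V} (h : G.Adj u w) :
    IsArc (emb.arc u w) (emb.pos u) (emb.pos w) :=
  emb.arc_curve u w h

lemma IsArc.right_mem {A : Set (ℝ × ℝ)} {a b : ℝ × ℝ} (h : IsArc A a b) : b ∈ A := by
  obtain ⟨γ, -, -, -, rfl, rfl⟩ := h
  exact Set.mem_image_of_mem γ (by simp)

lemma mem_of_pos_mem_arcSet (emb : PlaneEmbedding G) {e : Sym2 V} (he : e ∈ G.edgeSet) {y : V}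
    (hy : emb.pos y ∈ arcSet emb e) : y ∈ e := by
  induction e with
  | _ u w => exact Sym2.mem_iff.2 (emb.arc_vertex u w he y hy)

lemma exists_pos_eq_of_mem_arcSet (emb : PlaneEmbedding G) {e e' : Sym2 V} (he : e ∈ G.edgeSet)
    (he' : e' ∈ G.edgeSet) (hne : e ≠ e') {z : ℝ × ℝ} (hz : z ∈ arcSet emb e)
    (hz' : z ∈ arcSet emb e') : ∃ y, z = emb.pos y ∧ y ∈ e ∧ y ∈ e' := by
  have h : z ∈ Set.range emb.pos := by
    induction e with
    | _ u w =>
      induction e' with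
      | _ u' w' => exact emb.arc_inter u w u' w' he he' hne ⟨hz, hz'⟩
  obtain ⟨y, rfl⟩ := h
  exact ⟨y, rfl, mem_of_pos_mem_arcSet emb he hz, mem_of_pos_mem_arcSet emb he' hz'⟩

/-- `g` is a continuous logarithm of `z - p` on the part of the edge `e` in `F`, with prescribed
values `l` at the ends. -/
def IsEdgeLog (emb : PlaneEmbedding G) (F : Set (ℝ × ℝ)) (p : ℝ × ℝ) (l : V → ℂ) (e : Sym2 V)
    (g : ℝ × ℝ → ℂ) : Prop :=
  ContinuousOn g (arcSet emb e ∩ F) ∧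
    (∀ y ∈ arcSet emb e ∩ F, Complex.exp (g y) = planeDiff p y) ∧
    ∀ u ∈ e, emb.pos u ∈ F → g (emb.pos u) = l u

lemma exists_isEdgeLog_of_not_subset (emb : PlaneEmbedding G) {F : Set (ℝ × ℝ)}
    (hF : IsClosed F) {p : ℝ × ℝ} (hp : p ∉ F) {l : V → ℂ}
    (hl : ∀ u, emb.pos u ∈ F → Complex.exp (l u) = planeDiff p (emb.pos u))
    {e : Sym2 V} (he : e ∈ G.edgeSet) (hb : ¬ arcSet emb e ⊆ F) :
    ∃ g, IsEdgeLog emb F p l e g := by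
  induction e with
  | _ u w =>
    obtain ⟨g, h1, h2, h3, h4⟩ :=
      (emb.isArc he).exists_log_of_not_subset hF hb hp (hl u) (hl w)
    refine ⟨g, h1, h2, fun y hy => ?_⟩
    rcases Sym2.mem_iff.1 hy with rfl | rfl
    · exact h3
    · exact h4

/-- A value at `w` compatible with the value `l` at `u`, when the edge `uw` lies in `F`. -/
lemma exists_transport (emb : PlaneEmbedding G) {F : Set (ℝ × ℝ)} {p : ℝ × ℝ} (hp : p ∉ F)
    {u w : V} (h : G.Adj u w) (hw : emb.arc u w ⊆ F) {l : ℂ}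
    (hl : Complex.exp l = planeDiff p (emb.pos u)) :
    ∃ m : ℂ, Complex.exp m = planeDiff p (emb.pos w) ∧
      ∀ l' : V → ℂ, l' u = l → l' w = m → ∃ g, IsEdgeLog emb F p l' s(u, w) g := by
  obtain ⟨g, h1, h2, h3⟩ := (emb.isArc h).exists_log_of_subset hw hp hl
  refine ⟨g (emb.pos w), h2 _ (emb.isArc h).right_mem, fun l' hu hw' => ⟨g,
    h1.mono Set.inter_subset_left, fun y hy => h2 y hy.1, fun y hy _ => ?_⟩⟩
  rcases Sym2.mem_iff.1 hy with rfl | rfl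
  · rw [h3, hu]
  · exact hw'.symm

/-- If the only edges of `E` drawn inside `F` are edges at `v` and one edge `cd` whose end `d` is
not a neighbour of `v`, then `z - p` has a continuous logarithm on the part of the drawing
of `E` in `F`. -/
lemma exists_log_of_star [Fintype V] (emb : PlaneEmbedding G) {F : Set (ℝ × ℝ)} (hF : IsClosed F)
    {E : Set (Sym2 V)} (hE : E ⊆ G.edgeSet) (hFE : F ⊆ ⋃ e ∈ E, arcSet emb e)
    {v c d : V} (hcd : G.Adj c d) (hvd : ¬ G.Adj v d) (hdv : d ≠ v)
    (hwhole : ∀ e ∈ E, arcSet emb e ⊆ F → v ∈ e ∨ e = s(c, d)) {p : ℝ × ℝ} (hp : p ∉ F) :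
    ∃ g : ℝ × ℝ → ℂ, ContinuousOn g F ∧ ∀ y ∈ F, Complex.exp (g y) = planeDiff p y := by
  have hpos : ∀ {u}, emb.pos u ∈ F → planeDiff p (emb.pos u) ≠ 0 := fun hu =>
    planeDiff_ne_zero fun h => hp (h ▸ hu)
  set l₀ : V → ℂ := fun u => Complex.log (planeDiff p (emb.pos u)) with hl₀
  have hl₀e : ∀ u, emb.pos u ∈ F → Complex.exp (l₀ u) = planeDiff p (emb.pos u) :=
    fun u hu => Complex.exp_log (hpos hu)
  have hleft : ∀ {u w}, G.Adj u w → emb.arc u w ⊆ F → emb.pos u ∈ F := fun {u w} h hs => by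
    rw [emb.arc_symm] at hs
    exact hs (emb.isArc h.symm).right_mem
  have hst : ∀ u, ∃ m : ℂ, (emb.pos u ∈ F → Complex.exp m = planeDiff p (emb.pos u)) ∧
      (G.Adj v u → emb.arc v u ⊆ F →
        ∀ l' : V → ℂ, l' v = l₀ v → l' u = m → ∃ g, IsEdgeLog emb F p l' s(v, u) g) := by
    intro u
    by_cases h : G.Adj v u ∧ emb.arc v u ⊆ F
    · obtain ⟨m, hm, h'⟩ := exists_transport emb hp h.1 h.2 (hl₀e v (hleft h.1 h.2))
      exact ⟨m, fun _ => hm, fun _ _ => h'⟩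
    · exact ⟨l₀ u, hl₀e u, fun h1 h2 => absurd ⟨h1, h2⟩ h⟩
  choose l₁ hl₁e hl₁ using hst
  set l₂ : V → ℂ := fun u => if u = v then l₀ v else l₁ u with hl₂
  have hl₂e : ∀ u, emb.pos u ∈ F → Complex.exp (l₂ u) = planeDiff p (emb.pos u) := by
    intro u hu
    simp only [hl₂]
    split_ifs with h
    · subst h; exact hl₀e u hu
    · exact hl₁e u hu
  obtain ⟨m, hm, hm'⟩ : ∃ m : ℂ, (emb.pos d ∈ F → Complex.exp m = planeDiff p (emb.pos d)) ∧
      (emb.arc c d ⊆ F →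
        ∀ l' : V → ℂ, l' c = l₂ c → l' d = m → ∃ g, IsEdgeLog emb F p l' s(c, d) g) := by
    by_cases h : emb.arc c d ⊆ F
    · obtain ⟨m, hm, h'⟩ := exists_transport emb hp hcd h (hl₂e c (hleft hcd h))
      exact ⟨m, fun _ => hm, fun _ => h'⟩
    · exact ⟨l₂ d, hl₂e d, fun h1 => absurd h1 h⟩
  set l : V → ℂ := fun u => if u = d then m else l₂ u with hl
  have hle : ∀ u, emb.pos u ∈ F → Complex.exp (l u) = planeDiff p (emb.pos u) := by
    intro u hu
    simp only [hl]
    split_ifs with h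
    · subst h; exact hm hu
    · exact hl₂e u hu
  have hstar : ∀ u, G.Adj v u → emb.arc v u ⊆ F → ∃ g, IsEdgeLog emb F p l s(v, u) g := by
    intro u hvu hs
    have hud : u ≠ d := fun h => hvd (h ▸ hvu)
    exact hl₁ u hvu hs l (by simp [hl, hl₂, hdv.symm]) (by simp [hl, hl₂, hud, hvu.ne'])
  have hlog : ∀ e : E, ∃ g, IsEdgeLog emb F p l e g := by
    rintro ⟨e, he⟩
    by_cases hs : arcSet emb e ⊆ F
    · rcases hwhole e he hs with hv | rfl
      · obtain ⟨u, rfl⟩ := hv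
        exact hstar u (hE he) hs
      · exact hm' hs l (by simp [hl, hcd.ne]) (by simp [hl])
    · exact exists_isEdgeLog_of_not_subset emb hF hp hle (hE he) hs
  choose g hg using hlog
  have hcov : F = ⋃ e : E, arcSet emb e ∩ F := by
    ext y
    constructor
    · intro hy
      obtain ⟨e, he, hye⟩ := Set.mem_iUnion₂.1 (hFE hy)
      exact Set.mem_iUnion.2 ⟨⟨e, he⟩, hye, hy⟩
    · intro hy
      obtain ⟨e, hye⟩ := Set.mem_iUnion.1 hy
      exact hye.2
  have hclosed : ∀ e : E, IsClosed (arcSet emb e ∩ F) := by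
    rintro ⟨e, he⟩
    refine IsClosed.inter ?_ hF
    induction e with
    | _ u w => exact (emb.isArc (hE he)).isCompact.isClosed
  have := exists_log_of_finite_cover hclosed (planeDiff p) g (fun e => (hg e).1)
    (fun e => (hg e).2.1) (by
      rintro ⟨e, he⟩ ⟨e', he'⟩ y ⟨⟨hy, hyF⟩, hy', -⟩
      by_cases hee : e = e'
      · subst hee; rfl
      · obtain ⟨u, rfl, hu, hu'⟩ := exists_pos_eq_of_mem_arcSet emb (hE he) (hE he') hee hy hy'
        rw [(hg _).2.2 u hu hyF, (hg _).2.2 u hu' hyF])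
  rwa [← hcov] at this

lemma exists_mem_edgeSet_Hgraph [Fintype V] {x : V} {C : G.Walk x x} (hC : C.IsCycle)
    (hi : IsIsolating G C) (u : V) : ∃ e ∈ (Hgraph C).edgeSet, u ∈ e := by
  by_cases hu : u ∈ C.support
  · obtain ⟨e, he, hue⟩ :=
      (SimpleGraph.Walk.mem_support_iff_exists_mem_edges_of_not_nil hC.not_nil).1 hu
    refine ⟨e, ?_, hue⟩
    rw [Hgraph, SimpleGraph.edgeSet_deleteEdges]
    exact ⟨C.edges_subset_edgeSet he, fun h => h.2.1 he⟩
  · obtain ⟨w, hw⟩ : (Finset.univ.filter fun w => G.Adj u w).Nonempty := by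
      rw [← Finset.card_pos, (hi u hu).1]; norm_num
    refine ⟨s(u, w), ?_, Sym2.mem_mk_left u w⟩
    rw [Hgraph, SimpleGraph.edgeSet_deleteEdges]
    exact ⟨(Finset.mem_filter.1 hw).2, fun h => hu (h.2.2 u (Sym2.mem_mk_left u w))⟩

lemma drawingH_eq [Fintype V] (emb : PlaneEmbedding G) {x : V} {C : G.Walk x x} (hC : C.IsCycle)
    (hi : IsIsolating G C) :
    drawingH emb C = ⋃ e ∈ (Hgraph C).edgeSet, arcSet emb e := by
  have hsub : (Hgraph C).edgeSet ⊆ G.edgeSet :=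
    SimpleGraph.edgeSet_mono (SimpleGraph.deleteEdges_le _)
  ext y
  simp only [drawingH, drawingOn, Set.mem_union, Set.mem_iUnion]
  constructor
  · rintro (⟨u, -, rfl⟩ | ⟨u, w, h, -, -, hy⟩)
    · obtain ⟨e, he, w, rfl⟩ := exists_mem_edgeSet_Hgraph hC hi u
      refine ⟨s(u, w), he, ?_⟩
      have h := (emb.isArc (hsub he).symm).right_mem
      rwa [emb.arc_symm] at h
    · exact ⟨s(u, w), h, hy⟩
  · rintro ⟨e, he, hy⟩
    induction e with
    | _ u w => exact Or.inr ⟨u, w, he, trivial, trivial, hy⟩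

lemma three_le_card_edges_toFinset {x : V} {C : G.Walk x x} (hC : C.IsCycle) :
    3 ≤ C.edges.toFinset.card := by
  rw [List.toFinset_card_of_nodup hC.edges_nodup, SimpleGraph.Walk.length_edges]
  exact hC.three_le_length

end MinorFaces

/-- For a longest isolating cycle `C` of an essentially 4-connected plane graph `G`,
every minor face of `H` (the graph `G` minus all chords of `C`) is a `j`-face with
`j ≥ 2`: it is incident with at least two edges of `C`. -/
theorem stmt6_minor_face_two_C_edges
    {V : Type*} [Fintype V] {G : SimpleGraph V}
    (h4 : EssentiallyFourConnected G) (emb : PlaneEmbedding G)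
    {x : V} (C : G.Walk x x) (hC : IsLongestIsolatingCycle G C) :
    ∀ f : Set (ℝ × ℝ), MinorFaceH emb C f → 2 ≤ numCEdges emb C f := by
  intro f hf
  obtain ⟨⟨z, hz, hfz⟩, v, ⟨hv, -⟩, huniq⟩ := hf
  by_contra hlt
  obtain ⟨hcyc, hiso, -⟩ := id hC
  have hoff : ∀ w, w ∉ C.support → w ∈ Vminus emb C ∪ Vplus emb C := by
    intro w hw
    by_cases h : w ∈ Vminus emb C <;> simp [h, Vplus, hw]
  have hvC : v ∉ C.support := by
    rcases Finset.mem_union.1 hv with h | h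
    · exact (Finset.mem_filter.1 h).2.1
    · exact (Finset.mem_filter.1 h).2.1
  have hsub : (Hgraph C).edgeSet ⊆ G.edgeSet :=
    SimpleGraph.edgeSet_mono (SimpleGraph.deleteEdges_le _)
  have hD : drawingH emb C = ⋃ e ∈ (Hgraph C).edgeSet, arcSet emb e := drawingH_eq emb hcyc hiso
  have hDc : IsCompact (drawingH emb C) := by
    rw [hD]
    refine (Set.toFinite _).isCompact_biUnion fun e he => ?_
    induction e with
    | _ u w => exact (emb.isArc (hsub he)).isCompact
  have hfD : f ⊆ (drawingH emb C)ᶜ := hfz ▸ connectedComponentIn_subset _ _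
  have hop : IsOpen f := hfz ▸ hDc.isClosed.isOpen_compl.connectedComponentIn
  have hfr : frontier f = closure f \ f := hop.frontier_eq
  have hCE : ∀ e ∈ C.edges, e ∈ (Hgraph C).edgeSet := fun e he => by
    rw [Hgraph, SimpleGraph.edgeSet_deleteEdges]
    exact ⟨C.edges_subset_edgeSet he, fun h => h.2.1 he⟩
  have hcard : (C.edges.toFinset.filter fun e => incEdge emb f e).card ≤ 1 := by
    have : numCEdges emb C f ≤ 1 := by omega
    exact this
  obtain ⟨e₀, he₀, hinc⟩ : ∃ e₀ ∈ C.edges, ∀ e ∈ C.edges, incEdge emb f e → e = e₀ := by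
    rcases (C.edges.toFinset.filter fun e => incEdge emb f e).eq_empty_or_nonempty with h | ⟨e₀, h⟩
    · obtain ⟨e₀, he₀⟩ : C.edges.toFinset.Nonempty := by
        rw [← Finset.card_pos]
        have := three_le_card_edges_toFinset hcyc
        omega
      refine ⟨e₀, List.mem_toFinset.1 he₀, fun e he hi => ?_⟩
      exact absurd (Finset.mem_filter.2 ⟨List.mem_toFinset.2 he, hi⟩) (h ▸ Finset.notMem_empty e)
    · refine ⟨e₀, List.mem_toFinset.1 (Finset.mem_filter.1 h).1, fun e he hi => ?_⟩
      exact Finset.card_le_one.1 hcard e (Finset.mem_filter.2 ⟨List.mem_toFinset.2 he, hi⟩) e₀ h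
  obtain ⟨c, d, rfl, hvd⟩ : ∃ c d, e₀ = s(c, d) ∧ ¬ G.Adj v d := by
    induction e₀ with
    | _ c d =>
      by_cases h : G.Adj v c
      · exact ⟨c, d, rfl, hC.not_adj_of_mem_edges he₀ hvC h⟩
      · exact ⟨d, c, Sym2.eq_swap, h⟩
  have hdv : d ≠ v := fun h => hvC (h ▸ C.snd_mem_support_of_mem_edges he₀)
  have hwhole : ∀ e ∈ (Hgraph C).edgeSet, arcSet emb e ⊆ frontier f → v ∈ e ∨ e = s(c, d) := by
    intro e he hs
    have hs' : arcSet emb e ⊆ closure f := hs.trans frontier_subset_closure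
    by_cases heC : e ∈ C.edges
    · exact Or.inr (hinc e heC hs')
    · left
      have hch : ∃ w ∈ e, w ∉ C.support := by
        rw [Hgraph, SimpleGraph.edgeSet_deleteEdges] at he
        by_contra hcon
        push Not at hcon
        exact he.2 ⟨he.1, heC, hcon⟩
      obtain ⟨w, ⟨w', rfl⟩, hw⟩ := hch
      have hpw : emb.pos w ∈ closure f := by
        apply hs'
        have h := (emb.isArc (hsub he).symm).right_mem
        rwa [emb.arc_symm] at h
      rw [← huniq w ⟨hoff w hw, hpw⟩]
      exact Sym2.mem_mk_left w w'
  have hdense := compl_closure_face_eq_empty hDc subset_rfl hz hfz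
    (fun p hp => exists_log_of_star emb isClosed_frontier hsub
      (hD ▸ frontier_face_subset hDc.isClosed hfz) (C.adj_of_mem_edges he₀) hvd hdv hwhole hp)
    (fun y hy => by rwa [hfr] at hy)
  obtain ⟨e, he, hne⟩ := Finset.exists_mem_ne
    (lt_of_lt_of_le (by norm_num) (three_le_card_edges_toFinset hcyc)) s(c, d)
  exact hne (hinc e (List.mem_toFinset.1 he) fun y _ =>
    Set.compl_empty_iff.1 hdense ▸ Set.mem_univ y)

end
end
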